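/- Let M be a loopless matroid of rank r on a finite ground set E. Then there exist nonnegative integers w_0, w_1, …, w_r such that χ_M(q) = ∑_{k=0}^r (−1)^k w_k q^{r−k} as polynomials in q, and these satisfy w_k^2 ≥ w_{k−1} · w_{k+1} for all 1 ≤ k ≤ r−1. -/

import Mathlib

/-- The rank of a set `S` in a matroid `M`: the largest cardinality of an independent
subset of `S`. -/
noncomputable def matroidRank {α : Type*} (M : Matroid α) (S : Set α) : ℕ :=
  sSup {n : ℕ | ∃ I : Set α, I ⊆ S ∧ M.Indep I ∧ I.ncard = n}

open Matrix in
/-- A spectral form of the Bochner method: if a symmetric matrix has nonnegative off-diagonal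
entries with connected support, a positive vector with positive image, and dominates itself after
squaring in the induced weighted inner product, then it has only one positive eigenvalue. -/
theorem Matrix.dotProduct_mulVec_nonpos_of_bochner {ι : Type*} [Fintype ι] [DecidableEq ι]
    (A : Matrix ι ι ℝ) (hsymm : A.IsSymm) (hoff : ∀ i j, i ≠ j → 0 ≤ A i j)
    (v : ι → ℝ) (hv : ∀ i, 0 < v i) (hAv : ∀ i, 0 < (A *ᵥ v) i)
    (hconn : ∀ f : ι → ℝ, (∀ i j, i ≠ j → 0 < A i j → f i = f j) → ∀ i j, f i = f j)
    (hsq : ∀ x, x ⬝ᵥ A *ᵥ x ≤ ∑ i, v i * (A *ᵥ x) i ^ 2 / (A *ᵥ v) i)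
    (x : ι → ℝ) (hx : x ⬝ᵥ A *ᵥ v = 0) : x ⬝ᵥ A *ᵥ x ≤ 0 := by
  set b := A *ᵥ v with hb
  have key : ∀ (z : ι → ℝ) (c : ℝ), 0 < c → (∀ i, v i * (A *ᵥ z) i = c * b i * z i) →
      ∃ t : ℝ, ∀ i, z i = t * v i := by
    intro z c hc hz
    by_cases hz0 : z = 0
    · exact ⟨0, fun i => by simp [hz0]⟩
    have hpos : 0 < ∑ i, b i * z i ^ 2 / v i := by
      obtain ⟨i, hi⟩ := Function.ne_iff.mp hz0
      refine Finset.sum_pos' (fun j _ => by have := hv j; have := hAv j; positivity)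
        ⟨i, Finset.mem_univ i, ?_⟩
      have := hv i; have := hAv i; have : z i ≠ 0 := hi; positivity
    have hform : z ⬝ᵥ A *ᵥ z = c * ∑ i, b i * z i ^ 2 / v i := by
      rw [dotProduct, Finset.mul_sum]
      refine Finset.sum_congr rfl fun i _ => ?_
      have := hz i
      have hvi := (hv i).ne'
      field_simp
      linear_combination z i * this
    have hform2 : ∑ i, v i * (A *ᵥ z) i ^ 2 / b i = c ^ 2 * ∑ i, b i * z i ^ 2 / v i := by
      rw [Finset.mul_sum]
      refine Finset.sum_congr rfl fun i _ => ?_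
      have h1 := hz i
      have hvi := (hv i).ne'
      have hbi : b i ≠ 0 := (hAv i).ne'
      field_simp
      linear_combination (v i * (A *ᵥ z) i + c * b i * z i) * h1
    have hc1 : 1 ≤ c := by
      have h1 := hsq z
      rw [hform, hform2, sq, mul_assoc] at h1
      have h2 := le_of_mul_le_mul_left h1 hc
      by_contra hlt
      nlinarith
    have hid : ∑ i, ∑ j, A i j * v i * v j * (z i / v i - z j / v j) ^ 2
        = 2 * ((∑ i, b i * z i ^ 2 / v i) - z ⬝ᵥ A *ᵥ z) := by
      have e1 : ∑ i, b i * z i ^ 2 / v i = ∑ i, ∑ j, A i j * v j * (z i ^ 2 / v i) := by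
        refine Finset.sum_congr rfl fun i _ => ?_
        rw [hb, mulVec, dotProduct, mul_div_assoc, Finset.sum_mul]
      have e2 : ∑ i, b i * z i ^ 2 / v i = ∑ i, ∑ j, A i j * v i * (z j ^ 2 / v j) := by
        rw [e1, Finset.sum_comm]
        refine Finset.sum_congr rfl fun i _ => Finset.sum_congr rfl fun j _ => ?_
        rw [hsymm.apply]
      have e3 : z ⬝ᵥ A *ᵥ z = ∑ i, ∑ j, A i j * z i * z j := by
        rw [dotProduct]
        refine Finset.sum_congr rfl fun i _ => ?_
        rw [mulVec, dotProduct, Finset.mul_sum]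
        exact Finset.sum_congr rfl fun j _ => by ring
      rw [mul_sub, two_mul]
      nth_rewrite 1 [e1]
      rw [e2, e3, Finset.mul_sum, ← Finset.sum_add_distrib, ← Finset.sum_sub_distrib]
      refine Finset.sum_congr rfl fun i _ => ?_
      rw [Finset.mul_sum, ← Finset.sum_add_distrib, ← Finset.sum_sub_distrib]
      refine Finset.sum_congr rfl fun j _ => ?_
      have hvi := (hv i).ne'
      have hvj := (hv j).ne'
      field_simp
      ring
    have hnn : ∀ i j, 0 ≤ A i j * v i * v j * (z i / v i - z j / v j) ^ 2 := by
      intro i j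
      by_cases hij : i = j
      · simp [hij]
      · have := hoff i j hij; have := hv i; have := hv j; positivity
    have hle : ∑ i, ∑ j, A i j * v i * v j * (z i / v i - z j / v j) ^ 2 ≤ 0 := by
      rw [hid, hform]; nlinarith
    have hconst := hconn (fun i => z i / v i) (by
      intro i j _ hpos
      have h0 : A i j * v i * v j * (z i / v i - z j / v j) ^ 2 ≤ 0 := by
        refine le_trans ?_ hle
        refine le_trans (Finset.single_le_sum (fun j _ => hnn i j) (Finset.mem_univ j)) ?_
        exact Finset.single_le_sum (f := fun i => ∑ j, A i j * v i * v j * (z i / v i - z j / v j) ^ 2)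
          (fun i _ => Finset.sum_nonneg fun j _ => hnn i j) (Finset.mem_univ i)
      have h1 : 0 < A i j * v i * v j := by have := hv i; have := hv j; positivity
      have h2 : (z i / v i - z j / v j) ^ 2 ≤ 0 := by
        by_contra h; push Not at h; nlinarith [mul_pos h1 h]
      have h3 : z i / v i - z j / v j = 0 := by
        exact pow_eq_zero_iff (two_ne_zero) |>.mp (le_antisymm h2 (sq_nonneg _))
      linarith)
    obtain ⟨i, -⟩ := Function.ne_iff.mp hz0
    refine ⟨z i / v i, fun j => ?_⟩
    have h1 : z i / v i = z j / v j := hconst i j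
    rw [h1, div_mul_cancel₀ _ (hv j).ne']
  let p : ι → ℝ := fun i => √(v i / b i)
  have hp : ∀ i, 0 < p i := fun i => Real.sqrt_pos.mpr (div_pos (hv i) (hAv i))
  have hp2 : ∀ i, p i * p i = v i / b i := fun i =>
    Real.mul_self_sqrt (div_pos (hv i) (hAv i)).le
  let S : Matrix ι ι ℝ := Matrix.of fun i j => p i * A i j * p j
  have hS : S.IsHermitian := by
    ext i j
    simp only [S, conjTranspose_apply, of_apply, star_trivial]
    rw [hsymm.apply]; ring
  have hSmul : ∀ (y : ι → ℝ) i, (S *ᵥ y) i = p i * (A *ᵥ (fun j => p j * y j)) i := by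
    intro y i
    simp only [mulVec, dotProduct, S, of_apply, Finset.mul_sum]
    exact Finset.sum_congr rfl fun j _ => by ring
  let y : EuclideanSpace ℝ ι := WithLp.toLp 2 (fun i => x i / p i)
  have hyx : (fun j => p j * y j) = x := by
    funext j; simp only [y]; field_simp [(hp j).ne']
  have hform : x ⬝ᵥ A *ᵥ x = inner ℝ y (S.toEuclideanLin y) := by
    simp only [PiLp.inner_apply, Matrix.toLpLin_apply, RCLike.inner_apply, conj_trivial]
    rw [dotProduct]
    refine Finset.sum_congr rfl fun i _ => ?_
    rw [hSmul, hyx]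
    have := (hp i).ne'
    simp only [y]
    field_simp
  rw [hform, ← OrthonormalBasis.sum_inner_mul_inner hS.eigenvectorBasis]
  refine Finset.sum_nonpos fun k _ => ?_
  set e := hS.eigenvectorBasis k
  have he : S.toEuclideanLin e = (hS.eigenvalues k) • e := by
    rw [Matrix.toLpLin_apply]
    ext i
    have := congrFun (hS.mulVec_eigenvectorBasis k) i
    simpa using this
  have hsymS : inner ℝ e (S.toEuclideanLin y) = hS.eigenvalues k * inner ℝ e y := by
    have h := (Matrix.isSymmetric_toEuclideanLin_iff.mpr hS) e y
    rw [← h, he, inner_smul_left]; simp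
  rw [hsymS]
  rcases le_or_gt (hS.eigenvalues k) 0 with hneg | hpos
  · rw [real_inner_comm y e]
    nlinarith [mul_self_nonneg (inner ℝ y e), real_inner_comm y e]
  · obtain ⟨t, ht⟩ := key (fun j => p j * e j) _ hpos (by
      intro i
      have h1 := congrFun (hS.mulVec_eigenvectorBasis k) i
      change (S *ᵥ e) i = _ at h1
      rw [hSmul] at h1
      have h2 : v i = b i * (p i * p i) := by
        have hbi : b i ≠ 0 := (hAv i).ne'
        rw [hp2]; field_simp
      rw [h2]
      have h3 : (hS.eigenvalues k • ⇑e) i = hS.eigenvalues k * e i := rfl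
      have h1' : p i * (A *ᵥ fun j => p j * e.ofLp j) i = hS.eigenvalues k * e i := h1
      linear_combination (b i * p i) * h1')
    have h0 : inner ℝ y e = 0 := by
      simp only [PiLp.inner_apply, RCLike.inner_apply, conj_trivial]
      rw [← mul_zero t, ← hx, dotProduct, Finset.mul_sum]
      refine Finset.sum_congr rfl fun i _ => ?_
      have h1 : p i * e i = t * v i := ht i
      have h3 : p i * p i * b i = v i := by
        have hbi : b i ≠ 0 := (hAv i).ne'
        rw [hp2]; field_simp
      have hpi := (hp i).ne'
      have h4 : e i = t * (p i * b i) := by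
        apply mul_left_cancel₀ hpi
        rw [h1, ← h3]; ring
      simp only [y]
      rw [h4]
      field_simp
    rw [h0, zero_mul]

/-- A quadratic which takes a nonpositive value has nonnegative discriminant. -/
theorem mul_le_sq_of_quadratic_nonpos {a b c : ℝ} (t : ℝ) (hc : 0 < c)
    (h : a - 2 * t * b + t ^ 2 * c ≤ 0) : a * c ≤ b ^ 2 := by
  nlinarith [sq_nonneg (b - t * c), mul_nonneg hc.le (neg_nonneg.mpr h)]

/-- A finite bounded poset with a rank function and an additive size function satisfying the axioms
of a geometric lattice: the elements covering `A` inside `[A, B]` partition the size of `B` over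
that of `A`, and two elements covering `A` have a join of rank two over `A`. -/
structure GeometricGrading (P : Type*) [PartialOrder P] [BoundedOrder P] [Fintype P] where
  rk : P → ℕ
  size : P → ℝ
  rk_bot : rk ⊥ = 0
  size_bot : size ⊥ = 0
  rk_strictMono : StrictMono rk
  size_strictMono : StrictMono size
  sum_size_cover : ∀ A B, A < B → ∀ s : Finset P,
    (∀ F, F ∈ s ↔ A < F ∧ F ≤ B ∧ rk F = rk A + 1) → ∑ F ∈ s, (size F - size A) = size B - size A
  exists_join : ∀ A F G, A < F → A < G → rk F = rk A + 1 → rk G = rk A + 1 → F ≠ G →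
    ∃ L, rk L = rk A + 2 ∧ F ≤ L ∧ G ≤ L ∧ ∀ B, F ≤ B → G ≤ B → L ≤ B

namespace GeometricGrading

open scoped Classical

set_option linter.unusedSectionVars false

variable {P : Type*} [PartialOrder P] [BoundedOrder P] [Fintype P]

/-- A chain containing both bounds. -/
def IsFace (S : Finset P) : Prop :=
  ⊥ ∈ S ∧ ⊤ ∈ S ∧ ∀ F ∈ S, ∀ G ∈ S, F ≤ G ∨ G ≤ F

/-- The elements which extend the chain `S` to a larger chain. -/
noncomputable def link (S : Finset P) : Finset P :=
  {G | G ∉ S ∧ ∀ F ∈ S, F ≤ G ∨ G ≤ F}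

/-- `A < B` are consecutive elements of the chain `S`. -/
def Gap (S : Finset P) (A B : P) : Prop :=
  A ∈ S ∧ B ∈ S ∧ A < B ∧ ∀ F ∈ S, F ≤ A ∨ B ≤ F

/-- The largest element of the chain `S` below `G`. -/
noncomputable def lo (S : Finset P) (G : P) : P :=
  if h : ∃ A B, Gap S A B ∧ A < G ∧ G < B then h.choose else G

/-- The smallest element of the chain `S` above `G`. -/
noncomputable def hi (S : Finset P) (G : P) : P :=
  if h : ∃ A B, Gap S A B ∧ A < G ∧ G < B then h.choose_spec.choose else G

theorem mem_link {S : Finset P} {G : P} : G ∈ link S ↔ G ∉ S ∧ ∀ F ∈ S, F ≤ G ∨ G ≤ F := by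
  simp [link]

theorem Gap.unique {S : Finset P} {A B A' B' G : P} (h : Gap S A B) (h' : Gap S A' B')
    (hA : A < G) (hB : G < B) (hA' : A' < G) (hB' : G < B') : A = A' ∧ B = B' := by
  have key : ∀ {A B A' B' : P}, Gap S A B → Gap S A' B' → A < G → G < B → A' < G → G < B' →
      A' ≤ A ∧ B ≤ B' := by
    intro A B A' B' h h' hA hB hA' hB'
    exact ⟨(h.2.2.2 A' h'.1).resolve_right fun hle => lt_irrefl _ ((hB.trans_le hle).trans hA'),
      (h.2.2.2 B' h'.2.1).resolve_left fun hle => lt_irrefl _ ((hB'.trans_le hle).trans hA)⟩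
  have h1 := key h h' hA hB hA' hB'
  have h2 := key h' h hA' hB' hA hB
  exact ⟨le_antisymm h2.1 h1.1, le_antisymm h1.2 h2.2⟩

theorem Gap.lo_hi {S : Finset P} {A B G : P} (h : Gap S A B) (hA : A < G) (hB : G < B) :
    lo S G = A ∧ hi S G = B := by
  have hex : ∃ A B, Gap S A B ∧ A < G ∧ G < B := ⟨A, B, h, hA, hB⟩
  rw [lo, hi, dif_pos hex, dif_pos hex]
  obtain ⟨h1, h2, h3⟩ := hex.choose_spec.choose_spec
  exact h1.unique h h2 h3 hA hB

theorem exists_gap {S : Finset P} (hS : IsFace S) {G : P} (hG : G ∈ link S) :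
    ∃ A B, Gap S A B ∧ A < G ∧ G < B := by
  obtain ⟨hbot, htop, hch⟩ := hS
  rw [mem_link] at hG
  obtain ⟨hGS, hcomp⟩ := hG
  have h1 : (S.filter (· < G)).Nonempty :=
    ⟨⊥, by simpa [hbot] using bot_lt_iff_ne_bot.mpr (by rintro rfl; exact hGS hbot)⟩
  have h2 : (S.filter (G < ·)).Nonempty :=
    ⟨⊤, by simpa [htop] using lt_top_iff_ne_top.mpr (by rintro rfl; exact hGS htop)⟩
  obtain ⟨A, hA⟩ := Finset.exists_maximal h1
  obtain ⟨B, hB⟩ := Finset.exists_minimal h2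
  have hAm := Finset.mem_filter.mp hA.prop
  have hBm := Finset.mem_filter.mp hB.prop
  refine ⟨A, B, ⟨hAm.1, hBm.1, hAm.2.trans hBm.2, fun F hF => ?_⟩, hAm.2, hBm.2⟩
  rcases hcomp F hF with hle | hle
  · left
    have hlt : F < G := lt_of_le_of_ne hle fun h => hGS (h ▸ hF)
    rcases hch F hF A hAm.1 with h | h
    · exact h
    · exact hA.le_of_ge (Finset.mem_filter.mpr ⟨hF, hlt⟩) h
  · right
    have hlt : G < F := lt_of_le_of_ne hle fun h => hGS (h ▸ hF)
    rcases hch F hF B hBm.1 with h | h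
    · exact hB.le_of_le (Finset.mem_filter.mpr ⟨hF, hlt⟩) h
    · exact h

theorem Gap.mem_link {S : Finset P} {A B G : P} (h : Gap S A B) (hA : A < G) (hB : G < B) :
    G ∈ link S := by
  rw [GeometricGrading.mem_link]
  refine ⟨fun hG => ?_, fun F hF => ?_⟩
  · rcases h.2.2.2 G hG with h' | h'
    · exact lt_irrefl _ (hA.trans_le h')
    · exact lt_irrefl _ (hB.trans_le h')
  · rcases h.2.2.2 F hF with h' | h'
    · exact Or.inl (h'.trans hA.le)
    · exact Or.inr (hB.le.trans h')

theorem IsFace.insert {S : Finset P} (hS : IsFace S) {G : P} (hG : G ∈ link S) :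
    IsFace (insert G S) := by
  rw [mem_link] at hG
  refine ⟨Finset.mem_insert_of_mem hS.1, Finset.mem_insert_of_mem hS.2.1, fun F hF H hH => ?_⟩
  rw [Finset.mem_insert] at hF hH
  rcases hF with rfl | hF <;> rcases hH with rfl | hH
  · exact Or.inl le_rfl
  · exact (hG.2 H hH).symm
  · exact hG.2 F hF
  · exact hS.2.2 F hF H hH

theorem card_insert_link {S : Finset P} {G : P} (hG : G ∈ link S) :
    (insert G S).card = S.card + 1 :=
  Finset.card_insert_of_notMem (mem_link.mp hG).1

theorem mem_link_insert {S : Finset P} {G F : P} :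
    F ∈ link (insert G S) ↔ F ∈ link S ∧ F ≠ G ∧ (F ≤ G ∨ G ≤ F) := by
  simp only [mem_link, Finset.mem_insert, not_or, forall_eq_or_imp]
  tauto

theorem Gap.insert_left {S : Finset P} {A B G : P} (h : Gap S A B) (hA : A < G) (hB : G < B) :
    Gap (insert G S) A G := by
  refine ⟨Finset.mem_insert_of_mem h.1, Finset.mem_insert_self _ _, hA, fun F hF => ?_⟩
  rcases Finset.mem_insert.mp hF with rfl | hF
  · exact Or.inr le_rfl
  · exact (h.2.2.2 F hF).imp_right hB.le.trans

theorem Gap.insert_right {S : Finset P} {A B G : P} (h : Gap S A B) (hA : A < G) (hB : G < B) :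
    Gap (insert G S) G B := by
  refine ⟨Finset.mem_insert_self _ _, Finset.mem_insert_of_mem h.2.1, hB, fun F hF => ?_⟩
  rcases Finset.mem_insert.mp hF with rfl | hF
  · exact Or.inl le_rfl
  · exact (h.2.2.2 F hF).imp_left fun h' => h'.trans hA.le

theorem Gap.insert_of_le {S : Finset P} {A B G : P} (h : Gap S A B) (hG : G ≤ A ∨ B ≤ G) :
    Gap (insert G S) A B := by
  refine ⟨Finset.mem_insert_of_mem h.1, Finset.mem_insert_of_mem h.2.1, h.2.2.1, fun F hF => ?_⟩
  rcases Finset.mem_insert.mp hF with rfl | hF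
  · exact hG
  · exact h.2.2.2 F hF

theorem Gap.eq_or_disjoint {S : Finset P} {A B A' B' : P} (h : Gap S A B) (h' : Gap S A' B') :
    (A = A' ∧ B = B') ∨ B ≤ A' ∨ B' ≤ A := by
  rcases h.2.2.2 A' h'.1 with h1 | h1
  · rcases h.2.2.2 B' h'.2.1 with h2 | h2
    · exact Or.inr (Or.inr h2)
    · rcases h'.2.2.2 A h.1 with h3 | h3
      · rcases h'.2.2.2 B h.2.1 with h4 | h4
        · exact Or.inr (Or.inl h4)
        · exact Or.inl ⟨le_antisymm h3 h1, le_antisymm h2 h4⟩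
      · exact Or.inr (Or.inr h3)
  · exact Or.inr (Or.inl h1)

variable (g : GeometricGrading P)

/-- The value at `G` of the function `x` after subtracting its interpolation, affine in the size,
along the chain `S`. -/
noncomputable def norm (S : Finset P) (x : P → ℝ) (G : P) : ℝ :=
  x G - ((g.size (hi S G) - g.size G) * x (lo S G) + (g.size G - g.size (lo S G)) * x (hi S G)) /
    (g.size (hi S G) - g.size (lo S G))

theorem norm_eq {S : Finset P} {A B G : P} (h : Gap S A B) (hA : A < G) (hB : G < B)
    (x : P → ℝ) : g.norm S x G = x G - ((g.size B - g.size G) * x A + (g.size G - g.size A) * x B) /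
      (g.size B - g.size A) := by
  obtain ⟨h1, h2⟩ := h.lo_hi hA hB
  rw [norm, h1, h2]

theorem norm_add (S : Finset P) (x y : P → ℝ) (G : P) :
    g.norm S (x + y) G = g.norm S x G + g.norm S y G := by
  simp only [norm, Pi.add_apply]; ring

theorem norm_smul (S : Finset P) (a : ℝ) (x : P → ℝ) (G : P) :
    g.norm S (a • x) G = a * g.norm S x G := by
  simp only [norm, Pi.smul_apply, smul_eq_mul]; ring

theorem norm_insert {S : Finset P} (hS : IsFace S) {G F : P} (hG : G ∈ link S)
    (hF : F ∈ link (insert G S)) (x : P → ℝ) :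
    g.norm (insert G S) x F =
      g.norm S x F + g.norm S x G * g.norm (insert G S) (Pi.single G 1) F := by
  obtain ⟨A, B, hAB, hAG, hGB⟩ := exists_gap hS hG
  obtain ⟨hF, hne, hcomp⟩ := mem_link_insert.mp hF
  obtain ⟨A', B', hAB', hAF, hFB⟩ := exists_gap hS hF
  rcases hAB.eq_or_disjoint hAB' with ⟨rfl, rfl⟩ | hd
  · rw [g.norm_eq hAB hAF hFB, g.norm_eq hAB hAG hGB]
    have s1 := g.size_strictMono hAG
    have s2 := g.size_strictMono hGB
    have d0 : g.size B - g.size A ≠ 0 := by linarith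
    rcases hcomp with hle | hle
    · have hlt := lt_of_le_of_ne hle hne
      have hgap := hAB.insert_left hAG hGB
      rw [g.norm_eq hgap hAF hlt, g.norm_eq hgap hAF hlt]
      have d1 : g.size G - g.size A ≠ 0 := by linarith
      rw [Pi.single_eq_same, Pi.single_eq_of_ne hne, Pi.single_eq_of_ne hAG.ne]
      field_simp
      ring
    · have hlt := lt_of_le_of_ne hle hne.symm
      have hgap := hAB.insert_right hAG hGB
      rw [g.norm_eq hgap hlt hFB, g.norm_eq hgap hlt hFB]
      have d1 : g.size B - g.size G ≠ 0 := by linarith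
      rw [Pi.single_eq_same, Pi.single_eq_of_ne hne, Pi.single_eq_of_ne hGB.ne']
      field_simp
      ring
  · have hcmp : (G ≤ A' ∨ B' ≤ G) ∧ G ≠ A' ∧ G ≠ B' := by
      rcases hd with hd | hd
      · have h1 := hGB.trans_le hd
        exact ⟨Or.inl h1.le, h1.ne, (h1.trans hAB'.2.2.1).ne⟩
      · have h1 := hd.trans_lt hAG
        exact ⟨Or.inr h1.le, (hAB'.2.2.1.trans h1).ne', h1.ne'⟩
    have hgap := hAB'.insert_of_le hcmp.1
    rw [g.norm_eq hgap hAF hFB, g.norm_eq hgap hAF hFB, g.norm_eq hAB' hAF hFB,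
      Pi.single_eq_of_ne hne, Pi.single_eq_of_ne hcmp.2.1.symm, Pi.single_eq_of_ne hcmp.2.2.symm]
    simp

/-- The mixed volume of a list of functions on the star of the chain `S`. -/
noncomputable def vol : Finset P → List (P → ℝ) → ℝ
  | S, [] => if S.card = g.rk ⊤ + 1 then 1 else 0
  | S, x :: l => ∑ G ∈ link S, g.norm S x G * vol (insert G S) l

/-- The matrix of the bilinear form `(x, y) ↦ vol S (x :: y :: l)` in the coordinates `norm S`. -/
noncomputable def hess (S : Finset P) (l : List (P → ℝ)) (G F : P) : ℝ :=
  if F = G then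
    ∑ H ∈ link (insert G S), g.norm (insert G S) (Pi.single G 1) H * g.vol (insert H (insert G S)) l
  else if F ≤ G ∨ G ≤ F then g.vol (insert F (insert G S)) l else 0

theorem vol_add_cons (S : Finset P) (x y : P → ℝ) (l : List (P → ℝ)) :
    g.vol S ((x + y) :: l) = g.vol S (x :: l) + g.vol S (y :: l) := by
  simp only [vol, norm_add, add_mul, Finset.sum_add_distrib]

theorem vol_smul_cons (S : Finset P) (a : ℝ) (x : P → ℝ) (l : List (P → ℝ)) :
    g.vol S ((a • x) :: l) = a * g.vol S (x :: l) := by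
  simp only [vol, norm_smul, mul_assoc, Finset.mul_sum]

theorem hess_comm (S : Finset P) (l : List (P → ℝ)) (G F : P) :
    g.hess S l G F = g.hess S l F G := by
  rcases eq_or_ne F G with rfl | h
  · rfl
  · rw [hess, hess, if_neg h, if_neg h.symm, Finset.insert_comm]
    exact if_congr or_comm rfl rfl

theorem vol_insert_cons {S : Finset P} (hS : IsFace S) {G : P} (hG : G ∈ link S) (y : P → ℝ)
    (l : List (P → ℝ)) :
    g.vol (insert G S) (y :: l) = ∑ F ∈ link S, g.hess S l G F * g.norm S y F := by
  have h1 : ∀ F ∈ link (insert G S), g.norm (insert G S) y F * g.vol (insert F (insert G S)) l =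
      g.norm S y F * g.vol (insert F (insert G S)) l + g.norm S y G *
        (g.norm (insert G S) (Pi.single G 1) F * g.vol (insert F (insert G S)) l) := by
    intro F hF
    rw [g.norm_insert hS hG hF]; ring
  rw [vol, Finset.sum_congr rfl h1, Finset.sum_add_distrib, ← Finset.mul_sum,
    ← Finset.add_sum_erase _ _ hG, add_comm]
  congr 1
  · rw [hess, if_pos rfl, mul_comm]
  · have h2 : link (insert G S) ⊆ (link S).erase G := by
      intro F hF
      obtain ⟨h1, h2, -⟩ := mem_link_insert.mp hF
      exact Finset.mem_erase.mpr ⟨h2, h1⟩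
    rw [← Finset.sum_subset h2]
    · refine Finset.sum_congr rfl fun F hF => ?_
      obtain ⟨-, h2, h3⟩ := mem_link_insert.mp hF
      rw [hess, if_neg h2, if_pos h3, mul_comm]
    · intro F hF hF'
      rw [Finset.mem_erase] at hF
      rw [mem_link_insert] at hF'
      rw [hess, if_neg hF.1, if_neg (fun h => hF' ⟨hF.2, hF.1, h⟩), zero_mul]

theorem vol_cons_cons {S : Finset P} (hS : IsFace S) (x y : P → ℝ) (l : List (P → ℝ)) :
    g.vol S (x :: y :: l) =
      ∑ G ∈ link S, g.norm S x G * ∑ F ∈ link S, g.hess S l G F * g.norm S y F := by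
  rw [vol]
  exact Finset.sum_congr rfl fun G hG => by rw [g.vol_insert_cons hS hG]

theorem vol_swap {S : Finset P} (hS : IsFace S) (x y : P → ℝ) (l : List (P → ℝ)) :
    g.vol S (x :: y :: l) = g.vol S (y :: x :: l) := by
  simp only [g.vol_cons_cons hS, Finset.mul_sum]
  rw [Finset.sum_comm]
  refine Finset.sum_congr rfl fun G _ => Finset.sum_congr rfl fun F _ => ?_
  rw [g.hess_comm]; ring

theorem vol_perm {l l' : List (P → ℝ)} (h : l.Perm l') :
    ∀ S : Finset P, IsFace S → g.vol S l = g.vol S l' := by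
  induction h with
  | nil => exact fun _ _ => rfl
  | cons x _ ih =>
    intro S hS
    rw [vol, vol]
    exact Finset.sum_congr rfl fun G hG => by rw [ih _ (hS.insert hG)]
  | swap x y l => exact fun S hS => g.vol_swap hS _ _ _
  | trans _ _ ih1 ih2 => exact fun S hS => (ih1 S hS).trans (ih2 S hS)

theorem rk_le_top (F : P) : g.rk F ≤ g.rk ⊤ := g.rk_strictMono.monotone le_top

theorem exists_cover {A B : P} (h : A < B) : ∃ F, A < F ∧ F ≤ B ∧ g.rk F = g.rk A + 1 := by
  by_contra! hno
  have := g.sum_size_cover A B h ∅ (fun F => by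
    simp only [Finset.notMem_empty, false_iff]
    rintro ⟨h1, h2, h3⟩
    exact hno F h1 h2 h3)
  have := g.size_strictMono h
  simp at *
  linarith

theorem rk_injOn {S : Finset P} (hS : IsFace S) : Set.InjOn g.rk S := by
  intro F hF G hG h
  rcases hS.2.2 F hF G hG with h' | h'
  · by_contra hne
    exact (g.rk_strictMono (lt_of_le_of_ne h' hne)).ne h
  · by_contra hne
    exact (g.rk_strictMono (lt_of_le_of_ne h' (Ne.symm hne))).ne h.symm

theorem rk_notMem_of_mem_link {S : Finset P} (hS : IsFace S) {G : P} (hG : G ∈ link S) :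
    g.rk G ∉ S.image g.rk := by
  intro h
  obtain ⟨F, hF, hFG⟩ := Finset.mem_image.mp h
  have := g.rk_injOn (hS.insert hG) (Finset.mem_coe.mpr (Finset.mem_insert_of_mem hF))
    (Finset.mem_coe.mpr (Finset.mem_insert_self _ _)) hFG
  exact (mem_link.mp hG).1 (this ▸ hF)

theorem exists_gap_of_mem {S : Finset P} (hS : IsFace S) {A : P} (hA : A ∈ S) (hne : A ≠ ⊤) :
    ∃ B, Gap S A B := by
  have h2 : (S.filter (A < ·)).Nonempty :=
    ⟨⊤, by simpa [hS.2.1] using lt_top_iff_ne_top.mpr hne⟩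
  obtain ⟨B, hB⟩ := Finset.exists_minimal h2
  have hBm := Finset.mem_filter.mp hB.prop
  refine ⟨B, hA, hBm.1, hBm.2, fun F hF => ?_⟩
  rcases hS.2.2 F hF A hA with h | h
  · exact Or.inl h
  · rcases eq_or_lt_of_le h with rfl | hlt
    · exact Or.inl le_rfl
    · right
      rcases hS.2.2 F hF B hBm.1 with h | h
      · exact hB.le_of_le (Finset.mem_filter.mpr ⟨hF, hlt⟩) h
      · exact h

theorem link_nonempty {S : Finset P} (hS : IsFace S) (hcard : S.card < g.rk ⊤ + 1) :
    (link S).Nonempty := by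
  by_contra hemp
  have hall : ∀ j, j ≤ g.rk ⊤ → j ∈ S.image g.rk := by
    intro j
    induction j with
    | zero => exact fun _ => Finset.mem_image.mpr ⟨⊥, hS.1, g.rk_bot⟩
    | succ j ih =>
      intro hj
      obtain ⟨A, hA, hAj⟩ := Finset.mem_image.mp (ih (by omega))
      have hne : A ≠ ⊤ := by rintro rfl; omega
      obtain ⟨B, hAB⟩ := exists_gap_of_mem hS hA hne
      obtain ⟨F, hAF, hFB, hF⟩ := g.exists_cover hAB.2.2.1
      rcases eq_or_lt_of_le hFB with rfl | hlt
      · exact Finset.mem_image.mpr ⟨F, hAB.2.1, by omega⟩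
      · exact (hemp ⟨F, hAB.mem_link hAF hlt⟩).elim
  have h1 : Finset.range (g.rk ⊤ + 1) ⊆ S.image g.rk := fun j hj =>
    hall j (by simpa [Nat.lt_succ_iff] using hj)
  have h2 := (Finset.card_le_card h1).trans Finset.card_image_le
  rw [Finset.card_range] at h2
  omega

/-- Functions which are strictly concave in the size along every chain. -/
def IsAmple (c : P → ℝ) : Prop :=
  ∀ A G B : P, A < G → G < B →
    (g.size B - g.size G) * c A + (g.size G - g.size A) * c B < (g.size B - g.size A) * c G

theorem norm_pos {c : P → ℝ} (hc : g.IsAmple c) {S : Finset P} (hS : IsFace S) {G : P}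
    (hG : G ∈ link S) : 0 < g.norm S c G := by
  obtain ⟨A, B, hAB, hAG, hGB⟩ := exists_gap hS hG
  rw [g.norm_eq hAB hAG hGB, sub_pos, div_lt_iff₀ (sub_pos.mpr (g.size_strictMono hAB.2.2.1)),
    mul_comm (c G)]
  exact hc A G B hAG hGB

theorem vol_pos {l : List (P → ℝ)} (hl : ∀ c ∈ l, g.IsAmple c) :
    ∀ {S : Finset P}, IsFace S → S.card + l.length = g.rk ⊤ + 1 → 0 < g.vol S l := by
  induction l with
  | nil =>
    intro S _ hcard
    rw [vol, if_pos (by simpa using hcard)]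
    exact one_pos
  | cons c l ih =>
    intro S hS hcard
    rw [List.length_cons] at hcard
    rw [vol]
    refine Finset.sum_pos (fun G hG => mul_pos (g.norm_pos (hl c (by simp)) hS hG) ?_)
      (g.link_nonempty hS (by omega))
    exact ih (fun d hd => hl d (by simp [hd])) (hS.insert hG) (by rw [card_insert_link hG]; omega)

/-- The quadratic form of a linear space (two points lie on a unique line) is nonpositive on point
functions with sum zero. -/
theorem sum_incidence_eq_neg_sum_sq {s t : Finset P} {inc : P → P → ℝ} {u w : P → ℝ}
    (hinc : ∀ G F, inc G F * inc G F = inc G F)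
    (hpair : ∀ G ∈ s, ∀ G' ∈ s, G ≠ G' → ∑ F ∈ t, inc G F * inc G' F = 1)
    (hu : ∑ G ∈ s, u G = 0) :
    ∑ G ∈ s, u G * (∑ F ∈ t, inc G F * w F - (∑ F ∈ t, inc G F - 1) * u G) +
      ∑ F ∈ t, w F * (∑ G ∈ s, inc G F * u G - w F) =
    - ∑ F ∈ t, (w F - ∑ G ∈ s, inc G F * u G) ^ 2 := by
  have h1 : ∑ F ∈ t, (∑ G ∈ s, inc G F * u G) ^ 2 = ∑ G ∈ s, (∑ F ∈ t, inc G F - 1) * u G ^ 2 := by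
    have e1 : ∑ F ∈ t, (∑ G ∈ s, inc G F * u G) ^ 2 =
        ∑ G ∈ s, ∑ G' ∈ s, u G * u G' * ∑ F ∈ t, inc G F * inc G' F := by
      simp only [sq, Finset.sum_mul_sum]
      simp only [Finset.mul_sum]
      rw [Finset.sum_comm]
      refine Finset.sum_congr rfl fun G _ => ?_
      rw [Finset.sum_comm]
      exact Finset.sum_congr rfl fun G' _ => Finset.sum_congr rfl fun F _ => by ring
    have e2 : ∀ G ∈ s, ∑ G' ∈ s, u G * u G' * ∑ F ∈ t, inc G F * inc G' F =
        u G * ∑ G' ∈ s, u G' + (∑ F ∈ t, inc G F - 1) * u G ^ 2 := by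
      intro G hG
      rw [← Finset.add_sum_erase _ _ hG, ← Finset.add_sum_erase _ u hG]
      have : ∀ G' ∈ s.erase G, u G * u G' * ∑ F ∈ t, inc G F * inc G' F = u G * u G' := by
        intro G' hG'
        rw [hpair G hG G' (Finset.mem_of_mem_erase hG') (Finset.ne_of_mem_erase hG').symm, mul_one]
      rw [Finset.sum_congr rfl this, ← Finset.mul_sum, Finset.sum_congr rfl fun F _ => hinc G F]
      ring
    rw [e1, Finset.sum_congr rfl e2, Finset.sum_add_distrib, ← Finset.sum_mul, hu]
    simp
  have h2 : ∑ G ∈ s, u G * ∑ F ∈ t, inc G F * w F = ∑ F ∈ t, w F * ∑ G ∈ s, inc G F * u G := by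
    simp only [Finset.mul_sum]
    rw [Finset.sum_comm]
    exact Finset.sum_congr rfl fun _ _ => Finset.sum_congr rfl fun _ _ => by ring
  have h3 : ∑ F ∈ t, (w F - ∑ G ∈ s, inc G F * u G) ^ 2 = ∑ F ∈ t, w F ^ 2
      - 2 * ∑ F ∈ t, w F * ∑ G ∈ s, inc G F * u G + ∑ F ∈ t, (∑ G ∈ s, inc G F * u G) ^ 2 := by
    rw [Finset.mul_sum, ← Finset.sum_sub_distrib, ← Finset.sum_add_distrib]
    exact Finset.sum_congr rfl fun _ _ => by ring
  have h4 : ∑ G ∈ s, u G * (∑ F ∈ t, inc G F * w F - (∑ F ∈ t, inc G F - 1) * u G) =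
      ∑ G ∈ s, u G * ∑ F ∈ t, inc G F * w F - ∑ G ∈ s, (∑ F ∈ t, inc G F - 1) * u G ^ 2 := by
    rw [← Finset.sum_sub_distrib]
    exact Finset.sum_congr rfl fun _ _ => by ring
  have h5 : ∑ F ∈ t, w F * (∑ G ∈ s, inc G F * u G - w F) =
      ∑ F ∈ t, w F * ∑ G ∈ s, inc G F * u G - ∑ F ∈ t, w F ^ 2 := by
    rw [← Finset.sum_sub_distrib]
    exact Finset.sum_congr rfl fun _ _ => by ring
  rw [h3, h4, h5, h1, h2]
  ring

/-- If the quadratic form of `vol S (· :: · :: l)` is nonpositive on a hyperplane, then it satisfies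
the reversed Cauchy–Schwarz inequality against each vector on which it is positive. -/
theorem vol_mul_le_sq_of_nonpos {S : Finset P} (hS : IsFace S) {l : List (P → ℝ)}
    (a : (P → ℝ) →ₗ[ℝ] ℝ) (ha : ∀ z, a z = 0 → g.vol S (z :: z :: l) ≤ 0) {c : P → ℝ}
    (hc : 0 < g.vol S (c :: c :: l)) (x : P → ℝ) :
    g.vol S (x :: x :: l) * g.vol S (c :: c :: l) ≤ g.vol S (x :: c :: l) ^ 2 := by
  have hac : a c ≠ 0 := fun h => (ha c h).not_gt hc
  refine mul_le_sq_of_quadratic_nonpos (a x / a c) hc ?_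
  have h1 := ha (x + (-(a x / a c)) • c) (by
    rw [map_add, map_smul, smul_eq_mul]; field_simp; ring)
  rw [vol_add_cons, vol_smul_cons, g.vol_swap hS x, g.vol_swap hS c, vol_add_cons, vol_add_cons,
    vol_smul_cons, vol_smul_cons, g.vol_swap hS c x] at h1
  linarith

/-- The linear functional `x ↦ norm S x G`. -/
noncomputable def normLin (S : Finset P) (G : P) : (P → ℝ) →ₗ[ℝ] ℝ where
  toFun x := g.norm S x G
  map_add' x y := g.norm_add S x y G
  map_smul' a x := g.norm_smul S a x G

/-- The linear functional `x ↦ vol S (x :: l)`. -/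
noncomputable def volLin (S : Finset P) (l : List (P → ℝ)) : (P → ℝ) →ₗ[ℝ] ℝ where
  toFun x := g.vol S (x :: l)
  map_add' x y := g.vol_add_cons S x y l
  map_smul' a x := g.vol_smul_cons S a x l

theorem eq_of_rk_eq_of_comparable {F G : P} (h : g.rk F = g.rk G) (hc : F ≤ G ∨ G ≤ F) : F = G := by
  rcases hc with h' | h'
  · by_contra hne
    exact (g.rk_strictMono (lt_of_le_of_ne h' hne)).ne h
  · by_contra hne
    exact (g.rk_strictMono (lt_of_le_of_ne h' (Ne.symm hne))).ne h.symm

theorem lt_of_rk_lt_of_comparable {F G : P} (h : g.rk F < g.rk G) (hc : F ≤ G ∨ G ≤ F) : F < G := by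
  rcases hc with h' | h'
  · exact lt_of_le_of_ne h' fun e => h.ne (e ▸ rfl)
  · exact absurd (g.rk_strictMono.monotone h') (not_le.mpr h)

theorem le_of_rk_le_of_comparable {F G : P} (h : g.rk F ≤ g.rk G) (hc : F ≤ G ∨ G ≤ F) :
    F ≤ G := by
  rcases h.lt_or_eq with h | h
  · exact (g.lt_of_rk_lt_of_comparable h hc).le
  · exact (g.eq_of_rk_eq_of_comparable h hc).le

/-- The elements of rank `i` extending the chain `S`. -/
noncomputable def linkRk (S : Finset P) (i : ℕ) : Finset P := (link S).filter (g.rk · = i)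

theorem mem_linkRk {S : Finset P} {i : ℕ} {G : P} : G ∈ g.linkRk S i ↔ G ∈ link S ∧ g.rk G = i := by
  simp [linkRk]

section corank_two

variable {S : Finset P} {i j : ℕ} (hS : IsFace S) (hij : i < j)
  (hmiss : ∀ k, k ≤ g.rk ⊤ → (k ∉ S.image g.rk ↔ k = i ∨ k = j))
include hS hij hmiss

theorem link_rk_eq {G : P} (hG : G ∈ link S) : g.rk G = i ∨ g.rk G = j :=
  (hmiss _ (g.rk_le_top G)).mp (g.rk_notMem_of_mem_link hS hG)

theorem sum_link_eq (f : P → ℝ) :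
    ∑ G ∈ link S, f G = ∑ G ∈ g.linkRk S i, f G + ∑ G ∈ g.linkRk S j, f G := by
  rw [← Finset.sum_union]
  · refine Finset.sum_congr ?_ fun _ _ => rfl
    ext G
    simp only [Finset.mem_union, mem_linkRk]
    have := g.link_rk_eq hS hij hmiss (G := G)
    tauto
  · refine Finset.disjoint_left.mpr fun G h1 h2 => ?_
    have := (g.mem_linkRk.mp h1).2
    have := (g.mem_linkRk.mp h2).2
    omega

theorem vol_insert_singleton (hcard : S.card + 2 = g.rk ⊤ + 1) {k m : ℕ}
    (hkm : k = i ∧ m = j ∨ k = j ∧ m = i) {G : P} (hG : G ∈ g.linkRk S k) (x : P → ℝ) :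
    g.vol (insert G S) [x] = ∑ F ∈ (g.linkRk S m).filter (fun F => F ≤ G ∨ G ≤ F),
      (g.norm S x F + g.norm S x G * g.norm (insert G S) (Pi.single G 1) F) := by
  obtain ⟨hGl, hGk⟩ := g.mem_linkRk.mp hG
  have hlink : link (insert G S) = (g.linkRk S m).filter (fun F => F ≤ G ∨ G ≤ F) := by
    ext F
    simp only [mem_link_insert, Finset.mem_filter, mem_linkRk]
    constructor
    · rintro ⟨h1, h2, h3⟩
      refine ⟨⟨h1, ?_⟩, h3⟩
      have h4 := g.link_rk_eq hS hij hmiss h1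
      have h5 : g.rk F ≠ g.rk G := fun h => h2 (g.eq_of_rk_eq_of_comparable h h3)
      omega
    · rintro ⟨⟨h1, h2⟩, h3⟩
      exact ⟨h1, by rintro rfl; omega, h3⟩
  rw [vol, ← hlink]
  refine Finset.sum_congr rfl fun F hF => ?_
  rw [g.norm_insert hS hGl hF, vol, if_pos, mul_one]
  rw [card_insert_link hF, card_insert_link hGl]
  exact hcard

theorem vol_insert_singleton_of_mem_between (hcard : S.card + 2 = g.rk ⊤ + 1) {C : P} (hC : C ∈ S)
    (hiC : i < g.rk C) (hCj : g.rk C < j) {k m : ℕ}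
    (hkm : k = i ∧ m = j ∨ k = j ∧ m = i) {G : P} (hG : G ∈ g.linkRk S k) (x : P → ℝ) :
    g.vol (insert G S) [x] = ∑ F ∈ g.linkRk S m, g.norm S x F := by
  rw [g.vol_insert_singleton hS hij hmiss hcard hkm hG]
  obtain ⟨hGl, hGk⟩ := g.mem_linkRk.mp hG
  have hsep : ∀ F ∈ g.linkRk S m, (F < C ∧ C < G) ∨ (G < C ∧ C < F) := by
    intro F hF
    obtain ⟨hFl, hFm⟩ := g.mem_linkRk.mp hF
    have h1 := (mem_link.mp hGl).2 C hC
    have h2 := (mem_link.mp hFl).2 C hC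
    rcases hkm with h | h
    · exact Or.inr ⟨g.lt_of_rk_lt_of_comparable (by omega) h1.symm,
        g.lt_of_rk_lt_of_comparable (by omega) h2⟩
    · exact Or.inl ⟨g.lt_of_rk_lt_of_comparable (by omega) h2.symm,
        g.lt_of_rk_lt_of_comparable (by omega) h1⟩
  have hcomp : ∀ F ∈ g.linkRk S m, F ≤ G ∨ G ≤ F := fun F hF =>
    (hsep F hF).imp (fun h => (h.1.trans h.2).le) (fun h => (h.1.trans h.2).le)
  rw [Finset.filter_true_of_mem hcomp]
  refine Finset.sum_congr rfl fun F hF => ?_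
  have hFG : F ≠ G := by
    rcases hsep F hF with h | h
    · exact (h.1.trans h.2).ne
    · exact (h.1.trans h.2).ne'
  have hFl : F ∈ link (insert G S) :=
    mem_link_insert.mpr ⟨(g.mem_linkRk.mp hF).1, hFG, hcomp F hF⟩
  obtain ⟨A, B, hAB, hAF, hFB⟩ := exists_gap (hS.insert hGl) hFl
  have hCins := hAB.2.2.2 C (Finset.mem_insert_of_mem hC)
  have hne : A ≠ G ∧ B ≠ G := by
    rcases hsep F hF with h | h
    · refine ⟨(hAF.trans (h.1.trans h.2)).ne, ?_⟩
      have hBC : B ≤ C := hCins.resolve_left fun h' => lt_irrefl _ ((h.1.trans_le h').trans hAF)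
      exact (hBC.trans_lt h.2).ne
    · refine ⟨?_, ((h.1.trans h.2).trans hFB).ne'⟩
      have hCA : C ≤ A := hCins.resolve_right fun h' => lt_irrefl _ ((hFB.trans_le h').trans h.2)
      exact (h.1.trans_le hCA).ne'
  rw [g.norm_eq hAB hAF hFB, Pi.single_eq_of_ne hFG, Pi.single_eq_of_ne hne.1,
    Pi.single_eq_of_ne hne.2]
  simp

theorem vol_pair_eq (z : P → ℝ) : g.vol S [z, z] =
    ∑ G ∈ g.linkRk S i, g.norm S z G * g.vol (insert G S) [z] +
      ∑ F ∈ g.linkRk S j, g.norm S z F * g.vol (insert F S) [z] := by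
  rw [vol, g.sum_link_eq hS hij hmiss]

theorem vol_pair_eq_of_mem_between (hcard : S.card + 2 = g.rk ⊤ + 1) {C : P} (hC : C ∈ S)
    (hiC : i < g.rk C) (hCj : g.rk C < j) (z : P → ℝ) :
    g.vol S [z, z] =
      2 * (∑ G ∈ g.linkRk S i, g.norm S z G) * ∑ F ∈ g.linkRk S j, g.norm S z F := by
  have h1 := Finset.sum_congr (rfl : g.linkRk S i = g.linkRk S i) fun G hG =>
    congrArg (g.norm S z G * ·) (g.vol_insert_singleton_of_mem_between hS hij hmiss hcard hC hiC hCj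
      (Or.inl ⟨rfl, rfl⟩) hG z)
  have h2 := Finset.sum_congr (rfl : g.linkRk S j = g.linkRk S j) fun F hF =>
    congrArg (g.norm S z F * ·) (g.vol_insert_singleton_of_mem_between hS hij hmiss hcard hC hiC hCj
      (Or.inr ⟨rfl, rfl⟩) hF z)
  rw [g.vol_pair_eq hS hij hmiss, h1, h2, ← Finset.sum_mul, ← Finset.sum_mul]
  ring

theorem vol_pair_nonpos_of_adjacent (hcard : S.card + 2 = g.rk ⊤ + 1) (hadj : j = i + 1)
    (hi : 0 < i) (hj : j < g.rk ⊤) {z : P → ℝ} (hz : ∑ G ∈ g.linkRk S i, g.norm S z G = 0) :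
    g.vol S [z, z] ≤ 0 := by
  have hmem : ∀ k, k ≤ g.rk ⊤ → k ≠ i → k ≠ j → ∃ F ∈ S, g.rk F = k := by
    intro k hk h1 h2
    by_contra h
    exact ((hmiss k hk).mp fun h' => h (Finset.mem_image.mp h')).elim h1 h2
  obtain ⟨A, hA, hAi⟩ := hmem (i - 1) (by omega) (by omega) (by omega)
  obtain ⟨B, hB, hBj⟩ := hmem (j + 1) (by omega) (by omega) (by omega)
  have hgap : Gap S A B := by
    refine ⟨hA, hB, g.lt_of_rk_lt_of_comparable (by omega) (hS.2.2 A hA B hB), fun F hF => ?_⟩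
    have h1 : g.rk F ≠ i ∧ g.rk F ≠ j := by
      have := (hmiss _ (g.rk_le_top F)).not.mp (by simpa using ⟨F, hF, rfl⟩)
      tauto
    rcases le_or_gt (g.rk F) (g.rk A) with h | h
    · exact Or.inl (g.le_of_rk_le_of_comparable h (hS.2.2 F hF A hA))
    · exact Or.inr (g.le_of_rk_le_of_comparable (by omega) (hS.2.2 B hB F hF))
  have hbetw : ∀ k, (k = i ∨ k = j) → ∀ F ∈ g.linkRk S k, A < F ∧ F < B := by
    intro k hk F hF
    obtain ⟨hFl, hFk⟩ := g.mem_linkRk.mp hF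
    exact ⟨g.lt_of_rk_lt_of_comparable (by omega) ((mem_link.mp hFl).2 A hA),
      g.lt_of_rk_lt_of_comparable (by omega) ((mem_link.mp hFl).2 B hB).symm⟩
  have hsizeG : ∀ G ∈ g.linkRk S i,
      ∑ F ∈ (g.linkRk S j).filter (G < ·), (g.size F - g.size G) = g.size B - g.size G := by
    intro G hG
    refine g.sum_size_cover G B (hbetw i (Or.inl rfl) G hG).2 _ fun F => ?_
    simp only [Finset.mem_filter]
    have hGi := (g.mem_linkRk.mp hG).2
    constructor
    · rintro ⟨h1, h2⟩
      exact ⟨h2, (hbetw j (Or.inr rfl) F h1).2.le, by rw [(g.mem_linkRk.mp h1).2, hGi, hadj]⟩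
    · rintro ⟨h1, h2, h3⟩
      refine ⟨g.mem_linkRk.mpr ⟨hgap.mem_link ((hbetw i (Or.inl rfl) G hG).1.trans h1) ?_, ?_⟩, h1⟩
      · exact g.lt_of_rk_lt_of_comparable (by omega) (Or.inl h2)
      · omega
  have hsizeF : ∀ F ∈ g.linkRk S j,
      ∑ G ∈ (g.linkRk S i).filter (· < F), (g.size G - g.size A) = g.size F - g.size A := by
    intro F hF
    refine g.sum_size_cover A F (hbetw j (Or.inr rfl) F hF).1 _ fun G => ?_
    simp only [Finset.mem_filter]
    have hFj := (g.mem_linkRk.mp hF).2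
    constructor
    · rintro ⟨h1, h2⟩
      refine ⟨(hbetw i (Or.inl rfl) G h1).1, h2.le, ?_⟩
      rw [(g.mem_linkRk.mp h1).2]; omega
    · rintro ⟨h1, h2, h3⟩
      have h4 : G < F := g.lt_of_rk_lt_of_comparable (by omega) (Or.inl h2)
      refine ⟨g.mem_linkRk.mpr ⟨hgap.mem_link h1 (h4.trans (hbetw j (Or.inr rfl) F hF).2), ?_⟩, h4⟩
      omega
  set inc : P → P → ℝ := fun G F => if G < F then 1 else 0 with hinc
  have hvolG : ∀ G ∈ g.linkRk S i, g.vol (insert G S) [z] =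
      ∑ F ∈ g.linkRk S j, inc G F * g.norm S z F -
        (∑ F ∈ g.linkRk S j, inc G F - 1) * g.norm S z G := by
    intro G hG
    obtain ⟨hAG, hGB⟩ := hbetw i (Or.inl rfl) G hG
    have hd : g.size B - g.size G ≠ 0 := (sub_pos.mpr (g.size_strictMono hGB)).ne'
    have hfil : (g.linkRk S j).filter (fun F => F ≤ G ∨ G ≤ F) =
        (g.linkRk S j).filter (G < ·) := by
      refine Finset.filter_congr fun F hF => ⟨fun h => ?_, fun h => Or.inr h.le⟩
      exact g.lt_of_rk_lt_of_comparable
        (by rw [(g.mem_linkRk.mp hG).2, (g.mem_linkRk.mp hF).2]; exact hij) h.symm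
    have hterm : ∀ F ∈ (g.linkRk S j).filter (G < ·), g.norm S z F +
        g.norm S z G * g.norm (insert G S) (Pi.single G 1) F =
        g.norm S z F - g.norm S z G +
          g.norm S z G / (g.size B - g.size G) * (g.size F - g.size G) := by
      intro F hF
      obtain ⟨hF, hGF⟩ := Finset.mem_filter.mp hF
      rw [g.norm_eq (hgap.insert_right hAG hGB) hGF (hbetw j (Or.inr rfl) F hF).2,
        Pi.single_eq_same, Pi.single_eq_of_ne hGF.ne', Pi.single_eq_of_ne hGB.ne']
      field_simp
      ring
    rw [g.vol_insert_singleton hS hij hmiss hcard (Or.inl ⟨rfl, rfl⟩) hG, hfil,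
      Finset.sum_congr rfl hterm, Finset.sum_add_distrib, ← Finset.mul_sum, hsizeG G hG,
      Finset.sum_sub_distrib]
    simp only [hinc, ite_mul, one_mul, zero_mul, ← Finset.sum_filter, Finset.sum_const,
      nsmul_eq_mul, mul_one]
    field_simp
    ring
  have hvolF : ∀ F ∈ g.linkRk S j, g.vol (insert F S) [z] =
      ∑ G ∈ g.linkRk S i, inc G F * g.norm S z G - g.norm S z F := by
    intro F hF
    obtain ⟨hAF, hFB⟩ := hbetw j (Or.inr rfl) F hF
    have hd : g.size F - g.size A ≠ 0 := (sub_pos.mpr (g.size_strictMono hAF)).ne'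
    have hfil : (g.linkRk S i).filter (fun G => G ≤ F ∨ F ≤ G) =
        (g.linkRk S i).filter (· < F) := by
      refine Finset.filter_congr fun G hG => ⟨fun h => ?_, fun h => Or.inl h.le⟩
      exact g.lt_of_rk_lt_of_comparable
        (by rw [(g.mem_linkRk.mp hG).2, (g.mem_linkRk.mp hF).2]; exact hij) h
    have hterm : ∀ G ∈ (g.linkRk S i).filter (· < F), g.norm S z G +
        g.norm S z F * g.norm (insert F S) (Pi.single F 1) G =
        g.norm S z G - g.norm S z F / (g.size F - g.size A) * (g.size G - g.size A) := by
      intro G hG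
      obtain ⟨hG, hGF⟩ := Finset.mem_filter.mp hG
      rw [g.norm_eq (hgap.insert_left hAF hFB) (hbetw i (Or.inl rfl) G hG).1 hGF,
        Pi.single_eq_same, Pi.single_eq_of_ne hGF.ne, Pi.single_eq_of_ne hAF.ne]
      field_simp
      ring
    rw [g.vol_insert_singleton hS hij hmiss hcard (Or.inr ⟨rfl, rfl⟩) hF, hfil,
      Finset.sum_congr rfl hterm, Finset.sum_sub_distrib, ← Finset.mul_sum, hsizeF F hF]
    simp only [hinc, ite_mul, one_mul, zero_mul, ← Finset.sum_filter]
    field_simp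
  have hpair : ∀ G ∈ g.linkRk S i, ∀ G' ∈ g.linkRk S i, G ≠ G' →
      ∑ F ∈ g.linkRk S j, inc G F * inc G' F = 1 := by
    intro G hG G' hG' hne
    obtain ⟨hAG, hGB⟩ := hbetw i (Or.inl rfl) G hG
    obtain ⟨hAG', hGB'⟩ := hbetw i (Or.inl rfl) G' hG'
    have hGi := (g.mem_linkRk.mp hG).2
    have hGi' := (g.mem_linkRk.mp hG').2
    obtain ⟨L, hL, h1, h2, h3⟩ := g.exists_join A G G' hAG hAG' (by omega) (by omega) hne
    have hLB : L < B := g.lt_of_rk_lt_of_comparable (by omega) (Or.inl (h3 B hGB.le hGB'.le))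
    have h1' : G < L := g.lt_of_rk_lt_of_comparable (by omega) (Or.inl h1)
    have h2' : G' < L := g.lt_of_rk_lt_of_comparable (by omega) (Or.inl h2)
    rw [Finset.sum_eq_single_of_mem L
      (g.mem_linkRk.mpr ⟨hgap.mem_link (hAG.trans h1') hLB, by omega⟩)]
    · simp [hinc, h1', h2']
    · intro F hF hFL
      simp only [hinc, ite_mul, one_mul, zero_mul, ite_eq_right_iff, one_ne_zero, imp_false]
      intro h4 h5
      refine hFL (g.eq_of_rk_eq_of_comparable ?_ (Or.inr (h3 F h4.le h5.le)))
      rw [(g.mem_linkRk.mp hF).2]; omega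
  rw [g.vol_pair_eq hS hij hmiss,
    Finset.sum_congr rfl fun G hG => by rw [hvolG G hG],
    Finset.sum_congr (s₁ := g.linkRk S j) rfl fun F hF => by rw [hvolF F hF],
    sum_incidence_eq_neg_sum_sq (fun G F => by simp [hinc]) hpair hz]
  exact neg_nonpos.mpr (Finset.sum_nonneg fun _ _ => sq_nonneg _)

end corank_two

theorem vol_pair_mul_le_sq {S : Finset P} (hS : IsFace S) (hcard : S.card + 2 = g.rk ⊤ + 1)
    {c : P → ℝ} (hc : g.IsAmple c) (x : P → ℝ) :
    g.vol S [x, x] * g.vol S [c, c] ≤ g.vol S [x, c] ^ 2 := by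
  have himg : (S.image g.rk).card = S.card := Finset.card_image_of_injOn (g.rk_injOn hS)
  have hsub : S.image g.rk ⊆ Finset.range (g.rk ⊤ + 1) := by
    intro k hk
    obtain ⟨F, -, rfl⟩ := Finset.mem_image.mp hk
    exact Finset.mem_range.mpr (Nat.lt_succ_of_le (g.rk_le_top F))
  have htwo : (Finset.range (g.rk ⊤ + 1) \ S.image g.rk).card = 2 := by
    rw [Finset.card_sdiff_of_subset hsub, himg, Finset.card_range]; omega
  obtain ⟨i, j, hij, hmiss⟩ : ∃ i j, i < j ∧
      Finset.range (g.rk ⊤ + 1) \ S.image g.rk = {i, j} := by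
    obtain ⟨i, j, hij, h⟩ := Finset.card_eq_two.mp htwo
    rcases lt_or_gt_of_ne hij with h' | h'
    · exact ⟨i, j, h', h⟩
    · exact ⟨j, i, h', by rw [h, Finset.pair_comm]⟩
  have hjr : j ≤ g.rk ⊤ := by
    have : j ∈ Finset.range (g.rk ⊤ + 1) \ S.image g.rk := by rw [hmiss]; simp
    exact Nat.lt_succ_iff.mp (Finset.mem_range.mp (Finset.mem_sdiff.mp this).1)
  replace hmiss : ∀ k, k ≤ g.rk ⊤ → (k ∉ S.image g.rk ↔ k = i ∨ k = j) := by
    intro k hk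
    have := Finset.ext_iff.mp hmiss k
    rw [Finset.mem_sdiff, Finset.mem_range, Finset.mem_insert, Finset.mem_singleton] at this
    rw [← this]
    exact ⟨fun h => ⟨by omega, h⟩, fun h => h.2⟩
  refine g.vol_mul_le_sq_of_nonpos hS (∑ G ∈ g.linkRk S i, g.normLin S G) (fun z hz => ?_)
    (g.vol_pos (by simp [hc]) hS (by simpa using hcard)) x
  replace hz : ∑ G ∈ g.linkRk S i, g.norm S z G = 0 := by
    simpa [normLin, LinearMap.sum_apply] using hz
  by_cases hadj : j = i + 1
  · refine g.vol_pair_nonpos_of_adjacent hS hij hmiss hcard hadj ?_ ?_ hz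
    · rw [pos_iff_ne_zero]
      intro hi
      exact (hmiss 0 (Nat.zero_le _)).mpr (Or.inl hi.symm)
        (Finset.mem_image.mpr ⟨⊥, hS.1, g.rk_bot⟩)
    · refine lt_of_le_of_ne hjr fun h => ?_
      exact (hmiss j hjr).mpr (Or.inr rfl) (Finset.mem_image.mpr ⟨⊤, hS.2.1, h.symm⟩)
  · have h1 : i + 1 ∈ S.image g.rk := by
      by_contra h
      have := (hmiss (i + 1) (by omega)).mp h
      omega
    obtain ⟨C, hC, hCi⟩ := Finset.mem_image.mp h1
    rw [g.vol_pair_eq_of_mem_between hS hij hmiss hcard hC (by omega) (by omega), hz]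
    simp

theorem norm_eq_self {S : Finset P} (hS : IsFace S) {x : P → ℝ} (hx : ∀ F ∈ S, x F = 0) {G : P}
    (hG : G ∈ link S) : g.norm S x G = x G := by
  obtain ⟨A, B, hAB, hAG, hGB⟩ := exists_gap hS hG
  rw [g.norm_eq hAB hAG hGB, hx A hAB.1, hx B hAB.2.1]
  simp

/-- The comparability graph on the link of a chain missing at least three ranks is connected. -/
theorem link_connected {S : Finset P} (hS : IsFace S) (hcard : S.card + 3 ≤ g.rk ⊤ + 1)
    {β : Type*} (f : P → β)
    (hf : ∀ F ∈ link S, ∀ G ∈ link S, F < G → f F = f G) :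
    ∀ F ∈ link S, ∀ G ∈ link S, f F = f G := by
  intro F hF G hG
  have hcomp : ∀ F ∈ link S, ∀ G ∈ link S, F ≤ G ∨ G ≤ F → f F = f G := by
    intro F hF G hG h
    rcases eq_or_ne F G with rfl | hne
    · rfl
    · rcases h with h | h
      · exact hf F hF G hG (lt_of_le_of_ne h hne)
      · exact (hf G hG F hF (lt_of_le_of_ne h hne.symm)).symm
  obtain ⟨A, B, hAB, hAF, hFB⟩ := exists_gap hS hF
  obtain ⟨A', B', hAB', hAG, hGB⟩ := exists_gap hS hG
  rcases hAB.eq_or_disjoint hAB' with ⟨rfl, rfl⟩ | h | h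
  · have h1 := g.rk_strictMono hAF
    have h2 := g.rk_strictMono hFB
    by_cases hrk : g.rk B = g.rk A + 2
    · obtain ⟨H, hH⟩ := g.link_nonempty (hS.insert hF) (by rw [card_insert_link hF]; omega)
      obtain ⟨hHS, hHF, -⟩ := mem_link_insert.mp hH
      obtain ⟨A', B', hAB', hAH, hHB⟩ := exists_gap hS hHS
      have hside : H ≤ A ∨ B ≤ H := by
        rcases hAB.eq_or_disjoint hAB' with ⟨rfl, rfl⟩ | h | h
        · have h3 := g.rk_strictMono hAH
          have h4 := g.rk_strictMono hHB
          exact absurd (g.eq_of_rk_eq_of_comparable (by omega) (mem_link_insert.mp hH).2.2) hHF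
        · exact Or.inr (h.trans hAH.le)
        · exact Or.inl (hHB.le.trans h)
      have key : ∀ K, A < K → K < B → K ≤ H ∨ H ≤ K := fun K h3 h4 =>
        hside.symm.imp (fun h => h4.le.trans h) (fun h => h.trans h3.le)
      exact (hcomp F hF H hHS (key F hAF hFB)).trans (hcomp G hG H hHS (key G hAG hGB)).symm
    · obtain ⟨F₁, hAF₁, hF₁F, hF₁⟩ := g.exists_cover hAF
      obtain ⟨G₁, hAG₁, hG₁G, hG₁⟩ := g.exists_cover hAG
      have hF₁l := hAB.mem_link hAF₁ (hF₁F.trans_lt hFB)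
      have hG₁l := hAB.mem_link hAG₁ (hG₁G.trans_lt hGB)
      refine (hcomp F hF F₁ hF₁l (Or.inr hF₁F)).trans
        (Eq.trans ?_ (hcomp G hG G₁ hG₁l (Or.inr hG₁G)).symm)
      rcases eq_or_ne F₁ G₁ with rfl | hne
      · rfl
      obtain ⟨L, hL, hFL, hGL, hLmin⟩ := g.exists_join A F₁ G₁ hAF₁ hAG₁ hF₁ hG₁ hne
      have hLB : L < B := lt_of_le_of_ne (hLmin B (hF₁F.trans hFB.le) (hG₁G.trans hGB.le))
        (by rintro rfl; omega)
      have hLl := hAB.mem_link (hAF₁.trans_le hFL) hLB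
      exact (hcomp F₁ hF₁l L hLl (Or.inl hFL)).trans (hcomp G₁ hG₁l L hLl (Or.inl hGL)).symm
  · exact hcomp F hF G hG (Or.inl ((hFB.trans_le h).trans hAG).le)
  · exact hcomp F hF G hG (Or.inr ((hGB.trans_le h).trans hAF).le)

/-- The reversed Cauchy–Schwarz inequality for mixed volumes with ample entries. -/
theorem vol_mul_le_sq {l : List (P → ℝ)} (hl : ∀ c ∈ l, g.IsAmple c) :
    ∀ {S : Finset P}, IsFace S → S.card + l.length + 2 = g.rk ⊤ + 1 → ∀ {c : P → ℝ},
      g.IsAmple c → ∀ x, g.vol S (x :: x :: l) * g.vol S (c :: c :: l) ≤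
        g.vol S (x :: c :: l) ^ 2 := by
  induction l with
  | nil => exact fun hS hcard c hc x => g.vol_pair_mul_le_sq hS (by simpa using hcard) hc x
  | cons d l ih =>
    intro S hS hcard c hc x
    rw [List.length_cons] at hcard
    have hd : g.IsAmple d := hl d (by simp)
    have hl' : ∀ c ∈ l, g.IsAmple c := fun c hc => hl c (by simp [hc])
    have hposc : 0 < g.vol S (c :: c :: d :: l) := g.vol_pos (by
      simp only [List.mem_cons]
      rintro e (rfl | rfl | rfl | he)
      exacts [hc, hc, hd, hl' e he]) hS (by simp only [List.length_cons]; omega)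
    refine g.vol_mul_le_sq_of_nonpos hS (g.volLin S (d :: d :: l)) (fun z hz => ?_) hposc x
    change g.vol S (z :: d :: d :: l) = 0 at hz
    let A : Matrix (link S) (link S) ℝ := fun G F => g.hess S (d :: l) G F
    have hvec : ∀ (y : P → ℝ) (G : link S), A.mulVec (fun F => g.norm S y F) G =
        g.vol (insert (G : P) S) (y :: d :: l) := by
      intro y G
      rw [g.vol_insert_cons hS G.2]
      exact Finset.sum_coe_sort (link S) (fun F => g.hess S (d :: l) G F * g.norm S y F)
    have hdot : ∀ x y : P → ℝ, (fun F : link S => g.norm S x F) ⬝ᵥ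
        A.mulVec (fun F => g.norm S y F) = g.vol S (x :: y :: d :: l) := by
      intro x y
      rw [dotProduct, vol, ← Finset.sum_coe_sort (link S)]
      exact Finset.sum_congr rfl fun G _ => by rw [hvec]
    have hAv : ∀ G : link S, 0 < g.vol (insert (G : P) S) (d :: d :: l) := fun G =>
      g.vol_pos (by
        simp only [List.mem_cons]
        rintro e (rfl | rfl | he)
        exacts [hd, hd, hl' e he]) (hS.insert G.2)
        (by rw [card_insert_link G.2]; simp only [List.length_cons]; omega)
    rw [← hdot]
    refine Matrix.dotProduct_mulVec_nonpos_of_bochner A ?_ ?_ (fun F => g.norm S d F) ?_ ?_ ?_ ?_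
      _ ?_
    · ext G F
      exact g.hess_comm S _ _ _
    · intro G F hGF
      have hne : (F : P) ≠ G := fun h => hGF (Subtype.ext h.symm)
      simp only [A, hess, if_neg hne]
      split_ifs with h
      · have hF : (F : P) ∈ link (insert (G : P) S) := mem_link_insert.mpr ⟨F.2, hne, h⟩
        refine (g.vol_pos (by
          simp only [List.mem_cons]
          rintro e (rfl | he)
          exacts [hd, hl' e he]) ((hS.insert G.2).insert hF) ?_).le
        rw [card_insert_link hF, card_insert_link G.2, List.length_cons]
        omega
      · exact le_rfl
    · exact fun G => g.norm_pos hd hS G.2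
    · intro G
      rw [hvec]
      exact hAv G
    · intro f hf
      have hf' := g.link_connected hS (by omega)
        (fun F => if h : F ∈ link S then f ⟨F, h⟩ else 0) (by
          intro F hF G hG hFG
          rw [dif_pos hF, dif_pos hG]
          refine hf ⟨F, hF⟩ ⟨G, hG⟩ (fun h => hFG.ne (congrArg Subtype.val h)) ?_
          have hGl : G ∈ link (insert F S) := mem_link_insert.mpr ⟨hG, hFG.ne', Or.inr hFG.le⟩
          simp only [A, hess, if_neg hFG.ne', if_pos (Or.inr hFG.le : G ≤ F ∨ F ≤ G)]
          refine g.vol_pos (by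
            simp only [List.mem_cons]
            rintro e (rfl | he)
            exacts [hd, hl' e he]) ((hS.insert hF).insert hGl) ?_
          rw [card_insert_link hGl, card_insert_link hF, List.length_cons]
          omega)
      intro G F
      have := hf' G G.2 F F.2
      simpa using this
    · intro y
      obtain ⟨x, rfl⟩ : ∃ x : P → ℝ, (fun F : link S => g.norm S x F) = y := by
        refine ⟨fun F => if h : F ∈ link S then y ⟨F, h⟩ else 0, funext fun G => ?_⟩
        rw [g.norm_eq_self hS _ G.2]
        · simp
        · intro F hF
          rw [dif_neg fun h => (mem_link.mp h).1 hF]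
      rw [hdot, g.vol_perm (l' := d :: x :: x :: l) _ S hS, vol, ← Finset.sum_coe_sort (link S)]
      · refine Finset.sum_le_sum fun G _ => ?_
        rw [hvec, hvec, mul_div_assoc]
        refine mul_le_mul_of_nonneg_left ?_ (g.norm_pos hd hS G.2).le
        rw [le_div_iff₀ (hAv G)]
        exact ih hl' (hS.insert G.2) (by rw [card_insert_link G.2]; omega) hd x
      · exact ((List.Perm.swap d x l).cons x).trans (List.Perm.swap d x (x :: l))
    · rw [hdot]
      exact hz

/-- Functions which are concave in the size along every chain. -/
def IsNef (c : P → ℝ) : Prop :=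
  ∀ A G B : P, A < G → G < B →
    (g.size B - g.size G) * c A + (g.size G - g.size A) * c B ≤ (g.size B - g.size A) * c G

variable {g} in
theorem IsNef.isAmple_sub_sq {c : P → ℝ} (hc : g.IsNef c) {ε : ℝ} (hε : 0 < ε) :
    g.IsAmple (c + ε • fun F => -g.size F ^ 2) := by
  intro A G B hAG hGB
  have h1 := sub_pos.mpr (g.size_strictMono hAG)
  have h2 := sub_pos.mpr (g.size_strictMono hGB)
  have h3 := mul_pos hε (mul_pos (mul_pos h1 h2) (add_pos h1 h2))
  have h4 := hc A G B hAG hGB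
  simp only [Pi.add_apply, Pi.smul_apply, smul_eq_mul]
  nlinarith

theorem continuous_vol_map (y : P → ℝ) (l : List (P → ℝ)) :
    ∀ S : Finset P, Continuous fun ε : ℝ => g.vol S (l.map fun c => c + ε • y) := by
  induction l with
  | nil => exact fun S => continuous_const
  | cons c l ih =>
    intro S
    simp only [List.map_cons, vol, norm_add, norm_smul]
    exact continuous_finsetSum _ fun G _ => Continuous.mul (by fun_prop) (ih _)

theorem vol_mul_le_sq_of_isNef {l : List (P → ℝ)} (hl : ∀ c ∈ l, g.IsNef c) {S : Finset P}
    (hS : IsFace S) (hcard : S.card + l.length + 2 = g.rk ⊤ + 1) {c : P → ℝ} (hc : g.IsNef c)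
    (x : P → ℝ) :
    g.vol S (x :: x :: l) * g.vol S (c :: c :: l) ≤ g.vol S (x :: c :: l) ^ 2 := by
  set y : P → ℝ := fun F => -g.size F ^ 2
  have hlim : ∀ l : List (P → ℝ), Filter.Tendsto
      (fun ε : ℝ => g.vol S (l.map fun c => c + ε • y)) (nhdsWithin 0 (Set.Ioi 0))
      (nhds (g.vol S l)) := by
    intro l
    have := ((g.continuous_vol_map y l S).tendsto 0).mono_left
      (nhdsWithin_le_nhds (s := Set.Ioi 0))
    simpa using this
  refine le_of_tendsto_of_tendsto ((hlim (x :: x :: l)).mul (hlim (c :: c :: l)))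
    ((hlim (x :: c :: l)).pow 2) ?_
  filter_upwards [self_mem_nhdsWithin] with ε hε
  simp only [List.map_cons]
  refine g.vol_mul_le_sq ?_ hS (by simpa using hcard) (hc.isAmple_sub_sq hε) _
  intro d hd
  obtain ⟨e, he, rfl⟩ := List.mem_map.mp hd
  exact (hl e he).isAmple_sub_sq hε

/-- The indicator function of the elements other than the top. -/
noncomputable def alpha (F : P) : ℝ := if F = ⊤ then 0 else 1

/-- The indicator function of the elements other than the bottom. -/
noncomputable def beta (F : P) : ℝ := if F = ⊥ then 0 else 1

theorem isNef_alpha : g.IsNef alpha := by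
  intro A G B hAG hGB
  have h1 := sub_pos.mpr (g.size_strictMono hAG)
  have h2 := sub_pos.mpr (g.size_strictMono hGB)
  simp only [alpha, if_neg (hGB.trans_le le_top).ne, if_neg (hAG.trans_le le_top).ne]
  split_ifs <;> linarith

theorem isNef_beta : g.IsNef beta := by
  intro A G B hAG hGB
  have h1 := sub_pos.mpr (g.size_strictMono hAG)
  have h2 := sub_pos.mpr (g.size_strictMono hGB)
  simp only [beta, if_neg (bot_le.trans_lt hGB).ne', if_neg (bot_le.trans_lt hAG).ne']
  split_ifs <;> linarith

theorem norm_alpha {S : Finset P} {A B H : P} (h : Gap S A B) (hA : A < H) (hB : H < B) :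
    g.norm S alpha H =
      if B = ⊤ then (g.size H - g.size A) / (g.size B - g.size A) else 0 := by
  have hd : g.size B - g.size A ≠ 0 := (sub_pos.mpr (g.size_strictMono h.2.2.1)).ne'
  rw [g.norm_eq h hA hB, alpha, alpha, alpha, if_neg (hB.trans_le le_top).ne,
    if_neg (hA.trans_le le_top).ne]
  split_ifs <;> field_simp <;> ring

theorem norm_beta {S : Finset P} {A B H : P} (h : Gap S A B) (hA : A < H) (hB : H < B) :
    g.norm S beta H = if A = ⊥ then 1 - g.size H / g.size B else 0 := by
  have hd : g.size B - g.size A ≠ 0 := (sub_pos.mpr (g.size_strictMono h.2.2.1)).ne'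
  rw [g.norm_eq h hA hB, beta, beta, beta, if_neg (bot_le.trans_lt hB).ne',
    if_neg (bot_le.trans_lt hA).ne']
  split_ifs with h0
  · subst h0
    rw [g.size_bot, sub_zero] at *
    field_simp
    ring
  · field_simp
    ring

theorem sum_link_mul_alpha {S : Finset P} (hS : IsFace S) {G : P} (hG : Gap S G ⊤) (f : P → ℝ) :
    ∑ H ∈ link S, g.norm S alpha H * f H = ∑ H with G < H ∧ H < ⊤,
      (g.size H - g.size G) / (g.size ⊤ - g.size G) * f H := by
  have hsub : Finset.univ.filter (fun H => G < H ∧ H < ⊤) ⊆ link S := fun H hH =>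
    hG.mem_link (Finset.mem_filter.mp hH).2.1 (Finset.mem_filter.mp hH).2.2
  rw [← Finset.sum_subset hsub]
  · refine Finset.sum_congr rfl fun H hH => ?_
    obtain ⟨-, h1, h2⟩ := Finset.mem_filter.mp hH
    rw [g.norm_alpha hG h1 h2, if_pos rfl]
  · intro H hH hH'
    obtain ⟨A, B, hAB, hAH, hHB⟩ := exists_gap hS hH
    rw [g.norm_alpha hAB hAH hHB, if_neg, zero_mul]
    rintro rfl
    rcases hAB.eq_or_disjoint hG with ⟨rfl, -⟩ | h | h
    · exact hH' (by simp [hAH, hHB])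
    · exact absurd (hG.2.2.1.trans_le h) (lt_irrefl _)
    · exact absurd (hAB.2.2.1.trans_le h) (lt_irrefl _)

theorem sum_link_mul_beta {S : Finset P} (hS : IsFace S) {F : P} (hF : Gap S ⊥ F) (f : P → ℝ) :
    ∑ H ∈ link S, g.norm S beta H * f H = ∑ H with ⊥ < H ∧ H < F,
      (1 - g.size H / g.size F) * f H := by
  have hsub : Finset.univ.filter (fun H => ⊥ < H ∧ H < F) ⊆ link S := fun H hH =>
    hF.mem_link (Finset.mem_filter.mp hH).2.1 (Finset.mem_filter.mp hH).2.2
  rw [← Finset.sum_subset hsub]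
  · refine Finset.sum_congr rfl fun H hH => ?_
    obtain ⟨-, h1, h2⟩ := Finset.mem_filter.mp hH
    rw [g.norm_beta hF h1 h2, if_pos rfl]
  · intro H hH hH'
    obtain ⟨A, B, hAB, hAH, hHB⟩ := exists_gap hS hH
    rw [g.norm_beta hAB hAH hHB, if_neg, zero_mul]
    rintro rfl
    rcases hAB.eq_or_disjoint hF with ⟨-, rfl⟩ | h | h
    · exact hH' (by simp [hAH, hHB])
    · exact absurd (hAB.2.2.1.trans_le h) (lt_irrefl _)
    · exact absurd (hF.2.2.1.trans_le h) (lt_irrefl _)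

/-- A chain skips all the ranks strictly between those of consecutive elements. -/
theorem card_add_le_of_gaps {S : Finset P} (hS : IsFace S) {F G : P} (hF : Gap S ⊥ F)
    (hG : Gap S G ⊤) (hFG : F ≤ G) : S.card + g.rk F + g.rk ⊤ ≤ g.rk ⊤ + 3 + g.rk G := by
  have hsub : S.image g.rk ⊆ insert 0 (insert (g.rk ⊤) (Finset.Icc (g.rk F) (g.rk G))) := by
    intro k hk
    obtain ⟨H, hH, rfl⟩ := Finset.mem_image.mp hk
    simp only [Finset.mem_insert, Finset.mem_Icc]
    rcases hF.2.2.2 H hH with h1 | h1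
    · left; rw [le_bot_iff.mp h1, g.rk_bot]
    · rcases hG.2.2.2 H hH with h2 | h2
      · exact Or.inr (Or.inr ⟨g.rk_strictMono.monotone h1, g.rk_strictMono.monotone h2⟩)
      · right; left; rw [top_le_iff.mp h2]
  have h1 := (Finset.card_le_card hsub).trans ((Finset.card_insert_le _ _).trans
    (Nat.succ_le_succ (Finset.card_insert_le _ _)))
  rw [Finset.card_image_of_injOn (g.rk_injOn hS), Nat.card_Icc] at h1
  have h2 := g.rk_strictMono.monotone hFG
  omega

theorem card_add_le_of_gap_bot {S : Finset P} (hS : IsFace S) {F : P} (hF : Gap S ⊥ F) :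
    S.card + g.rk F ≤ g.rk ⊤ + 2 := by
  have hsub : S.image g.rk ⊆ insert 0 (Finset.Icc (g.rk F) (g.rk ⊤)) := by
    intro k hk
    obtain ⟨H, hH, rfl⟩ := Finset.mem_image.mp hk
    simp only [Finset.mem_insert, Finset.mem_Icc]
    rcases hF.2.2.2 H hH with h1 | h1
    · left; rw [le_bot_iff.mp h1, g.rk_bot]
    · exact Or.inr ⟨g.rk_strictMono.monotone h1, g.rk_le_top H⟩
  have h1 := (Finset.card_le_card hsub).trans (Finset.card_insert_le _ _)
  rw [Finset.card_image_of_injOn (g.rk_injOn hS), Nat.card_Icc] at h1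
  have := g.rk_le_top F
  omega

section recursion

variable {b : P → ℝ} (hb₀ : b ⊥ = 1) (hb : ∀ F, F ≠ ⊥ →
  b F = ∑ H with H < F ∧ g.rk H + 1 = g.rk F, (1 - g.size H / g.size F) * b H)
include hb₀ hb

theorem vol_replicate_beta (k : ℕ) : ∀ {S : Finset P}, IsFace S → ∀ {F : P}, Gap S ⊥ F →
    S.card + k = g.rk ⊤ + 1 →
      g.vol S (List.replicate k beta) = if g.rk F = k + 1 then b F else 0 := by
  induction k with
  | zero =>
    intro S hS F hF hcard
    have h1 := g.card_add_le_of_gap_bot hS hF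
    have h2 := g.rk_strictMono hF.2.2.1
    have h3 := g.rk_bot
    rw [List.replicate_zero, vol, if_pos (by omega), if_pos (by omega), hb F hF.2.2.1.ne',
      Finset.sum_eq_single ⊥]
    · rw [hb₀, g.size_bot]; simp
    · intro H hH hne
      have h4 := g.rk_strictMono (bot_lt_iff_ne_bot.mpr hne)
      have h5 := (Finset.mem_filter.mp hH).2.2
      omega
    · intro h
      exact absurd (Finset.mem_filter.mpr ⟨Finset.mem_univ _, hF.2.2.1, by omega⟩) h
  | succ k ih =>
    intro S hS F hF hcard
    have h1 := g.card_add_le_of_gap_bot hS hF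
    rw [List.replicate_succ, vol, g.sum_link_mul_beta hS hF]
    have hstep : ∀ H ∈ Finset.univ.filter (fun H => ⊥ < H ∧ H < F),
        (1 - g.size H / g.size F) * g.vol (insert H S) (List.replicate k beta) =
        if g.rk H = k + 1 then (1 - g.size H / g.size F) * b H else 0 := by
      intro H hH
      obtain ⟨-, h2, h3⟩ := Finset.mem_filter.mp hH
      have hl := hF.mem_link h2 h3
      rw [ih (hS.insert hl) (hF.insert_left h2 h3) (by rw [card_insert_link hl]; omega), mul_ite,
        mul_zero]
    rw [Finset.sum_congr rfl hstep, ← Finset.sum_filter, Finset.filter_filter]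
    split_ifs with hrk
    · rw [hb F hF.2.2.1.ne']
      refine Finset.sum_congr (Finset.filter_congr fun H _ => ?_) fun _ _ => rfl
      constructor
      · rintro ⟨⟨h2, h3⟩, h4⟩
        exact ⟨h3, by omega⟩
      · rintro ⟨h3, h4⟩
        refine ⟨⟨bot_lt_iff_ne_bot.mpr ?_, h3⟩, by omega⟩
        rintro rfl
        rw [g.rk_bot] at h4
        omega
    · refine Finset.sum_eq_zero fun H hH => ?_
      obtain ⟨-, ⟨-, h2⟩, h3⟩ := Finset.mem_filter.mp hH
      have := g.rk_strictMono h2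
      omega

theorem vol_replicate_alpha_append (k a : ℕ) : ∀ {S : Finset P}, IsFace S → ∀ {F G : P},
    Gap S ⊥ F → Gap S G ⊤ → F ≤ G → S.card + (a + k) = g.rk ⊤ + 1 →
      g.vol S (List.replicate a alpha ++ List.replicate k beta) =
        if g.rk F = k + 1 ∧ g.rk G + a + 1 = g.rk ⊤ then b F else 0 := by
  induction a with
  | zero =>
    intro S hS F G hF hG hFG hcard
    have h1 := g.card_add_le_of_gaps hS hF hG hFG
    have h2 := g.rk_strictMono hG.2.2.1
    rw [List.replicate_zero, List.nil_append, g.vol_replicate_beta hb₀ hb k hS hF (by omega)]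
    refine if_congr ?_ rfl rfl
    constructor
    · intro h; omega
    · exact fun h => h.1
  | succ a ih =>
    intro S hS F G hF hG hFG hcard
    have h1 := g.card_add_le_of_gaps hS hF hG hFG
    rw [List.replicate_succ, List.cons_append, vol, g.sum_link_mul_alpha hS hG]
    have hstep : ∀ H ∈ Finset.univ.filter (fun H => G < H ∧ H < ⊤),
        (g.size H - g.size G) / (g.size ⊤ - g.size G) *
          g.vol (insert H S) (List.replicate a alpha ++ List.replicate k beta) =
        if g.rk F = k + 1 ∧ g.rk H + a + 1 = g.rk ⊤ then
          (g.size H - g.size G) * (b F / (g.size ⊤ - g.size G)) else 0 := by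
      intro H hH
      obtain ⟨-, h2, h3⟩ := Finset.mem_filter.mp hH
      have hl := hG.mem_link h2 h3
      rw [ih (hS.insert hl) (hF.insert_of_le (Or.inr (hFG.trans h2.le))) (hG.insert_right h2 h3)
        (hFG.trans h2.le) (by rw [card_insert_link hl]; omega), mul_ite, mul_zero]
      refine if_congr Iff.rfl ?_ rfl
      ring
    rw [Finset.sum_congr rfl hstep, ← Finset.sum_filter, Finset.filter_filter]
    split_ifs with hrk
    · rw [← Finset.sum_mul, g.sum_size_cover G ⊤ hG.2.2.1]
      · have : g.size ⊤ - g.size G ≠ 0 := (sub_pos.mpr (g.size_strictMono hG.2.2.1)).ne'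
        field_simp
      · intro H
        simp only [Finset.mem_filter, Finset.mem_univ, true_and]
        constructor
        · rintro ⟨⟨h2, h3⟩, h4⟩
          exact ⟨h2, le_top, by omega⟩
        · rintro ⟨h2, h3, h4⟩
          exact ⟨⟨h2, g.lt_of_rk_lt_of_comparable (by omega) (Or.inl le_top)⟩, by omega⟩
    · refine Finset.sum_eq_zero fun H hH => ?_
      obtain ⟨-, ⟨h2, -⟩, h3⟩ := Finset.mem_filter.mp hH
      have := g.rk_strictMono h2
      omega

end recursion

theorem exists_le_rk_eq (F : P) : ∀ k ≤ g.rk F, ∃ H ≤ F, g.rk H = k := by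
  intro k
  induction k with
  | zero => exact fun _ => ⟨⊥, bot_le, g.rk_bot⟩
  | succ k ih =>
    intro hk
    obtain ⟨H, hHF, hH⟩ := ih (by omega)
    obtain ⟨H', -, h1, h2⟩ :=
      g.exists_cover (g.lt_of_rk_lt_of_comparable (by omega) (Or.inl hHF))
    exact ⟨H', h1, by omega⟩

theorem isFace_pair : IsFace ({⊥, ⊤} : Finset P) := by
  refine ⟨by simp, by simp, fun F _ G hG => ?_⟩
  rcases Finset.mem_insert.mp hG with rfl | hG
  · exact Or.inr bot_le
  · rw [Finset.mem_singleton.mp hG]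
    exact Or.inl le_top

theorem gap_pair (h : (⊥ : P) < ⊤) : Gap ({⊥, ⊤} : Finset P) ⊥ ⊤ := by
  refine ⟨by simp, by simp, h, fun F hF => ?_⟩
  rcases Finset.mem_insert.mp hF with rfl | hF
  · exact Or.inl le_rfl
  · rw [Finset.mem_singleton.mp hF]
    exact Or.inr le_rfl

section recursion

variable {b : P → ℝ} (hb₀ : b ⊥ = 1) (hb : ∀ F, F ≠ ⊥ →
  b F = ∑ H with H < F ∧ g.rk H + 1 = g.rk F, (1 - g.size H / g.size F) * b H)

theorem size_pos {F : P} (hF : F ≠ ⊥) : 0 < g.size F := by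
  have := g.size_strictMono (bot_lt_iff_ne_bot.mpr hF)
  rwa [g.size_bot] at this

include hb₀ hb

theorem pos_of_recursion (F : P) : 0 < b F := by
  induction h : g.rk F using Nat.strong_induction_on generalizing F with
  | _ k ih =>
    subst h
    rcases eq_or_ne F ⊥ with rfl | hF
    · rw [hb₀]; exact one_pos
    · rw [hb F hF]
      have h0 := g.rk_strictMono (bot_lt_iff_ne_bot.mpr hF)
      refine Finset.sum_pos (fun H hH => mul_pos ?_ ?_) ?_
      · obtain ⟨-, h1, h2⟩ := Finset.mem_filter.mp hH
        rw [sub_pos, div_lt_one (g.size_pos hF)]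
        exact g.size_strictMono h1
      · obtain ⟨-, h1, h2⟩ := Finset.mem_filter.mp hH
        exact ih _ (by omega) H rfl
      · obtain ⟨H, h1, h2⟩ := g.exists_le_rk_eq F (g.rk F - 1) (by omega)
        exact ⟨H, Finset.mem_filter.mpr ⟨Finset.mem_univ _,
          g.lt_of_rk_lt_of_comparable (by omega) (Or.inl h1), by omega⟩⟩

theorem vol_pair_alpha_beta {a k : ℕ} (hak : a + k + 1 = g.rk ⊤) :
    g.vol {⊥, ⊤} (List.replicate a alpha ++ List.replicate k beta) =
      ∑ H with g.rk H = k + 1, g.size H / g.size ⊤ * b H := by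
  have hlt : (⊥ : P) < ⊤ := by
    rw [bot_lt_iff_ne_bot]
    intro h
    rw [h, g.rk_bot] at hak
    omega
  have hcard : ({⊥, ⊤} : Finset P).card = 2 := Finset.card_pair hlt.ne
  cases a with
  | zero =>
    rw [List.replicate_zero, List.nil_append,
      g.vol_replicate_beta hb₀ hb k isFace_pair (gap_pair hlt) (by omega), if_pos (by omega),
      Finset.sum_eq_single ⊤, div_self (g.size_pos hlt.ne').ne', one_mul]
    · intro H hH hne
      have h1 := (Finset.mem_filter.mp hH).2
      have h2 := g.rk_strictMono (lt_top_iff_ne_top.mpr hne)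
      omega
    · intro h
      exact absurd (Finset.mem_filter.mpr ⟨Finset.mem_univ _, by omega⟩) h
  | succ a =>
    rw [List.replicate_succ, List.cons_append, vol, g.sum_link_mul_alpha isFace_pair
      (gap_pair hlt)]
    have hstep : ∀ H ∈ Finset.univ.filter (fun H : P => ⊥ < H ∧ H < ⊤),
        (g.size H - g.size ⊥) / (g.size ⊤ - g.size ⊥) *
          g.vol (insert H {⊥, ⊤}) (List.replicate a alpha ++ List.replicate k beta) =
        if g.rk H = k + 1 then g.size H / g.size ⊤ * b H else 0 := by
      intro H hH
      obtain ⟨-, h2, h3⟩ := Finset.mem_filter.mp hH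
      have hl := (gap_pair hlt).mem_link h2 h3
      rw [g.vol_replicate_alpha_append hb₀ hb k a (isFace_pair.insert hl)
        ((gap_pair hlt).insert_left h2 h3) ((gap_pair hlt).insert_right h2 h3) le_rfl
        (by rw [card_insert_link hl]; omega), g.size_bot, sub_zero, sub_zero, mul_ite, mul_zero]
      exact if_congr (by omega) rfl rfl
    rw [Finset.sum_congr rfl hstep, ← Finset.sum_filter, Finset.filter_filter]
    refine Finset.sum_congr (Finset.filter_congr fun H _ => ⟨fun h => h.2, fun h => ?_⟩)
      fun _ _ => rfl
    refine ⟨⟨bot_lt_iff_ne_bot.mpr ?_, lt_top_iff_ne_top.mpr ?_⟩, h⟩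
    · rintro rfl
      rw [g.rk_bot] at h
      omega
    · rintro rfl
      omega

/-- The coefficients of the reduced characteristic polynomial form a log-concave sequence. -/
theorem reduced_log_concave (k : ℕ) :
    (∑ H with g.rk H = k, g.size H / g.size ⊤ * b H) *
      (∑ H with g.rk H = k + 2, g.size H / g.size ⊤ * b H) ≤
    (∑ H with g.rk H = k + 1, g.size H / g.size ⊤ * b H) ^ 2 := by
  rcases Nat.eq_zero_or_pos k with rfl | hk
  · rw [Finset.sum_eq_zero (s := Finset.univ.filter (fun H => g.rk H = 0)), zero_mul]
    · positivity
    · intro H hH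
      have h1 := (Finset.mem_filter.mp hH).2
      have h2 : H = ⊥ := g.eq_of_rk_eq_of_comparable (by rw [h1, g.rk_bot]) (Or.inr bot_le)
      rw [h2, g.size_bot]
      simp
  obtain ⟨m, rfl⟩ : ∃ m, k = m + 1 := ⟨k - 1, by omega⟩
  by_cases hr : g.rk ⊤ < m + 1 + 2
  · rw [Finset.sum_eq_zero (s := Finset.univ.filter (fun H => g.rk H = m + 1 + 2)), mul_zero]
    · positivity
    · intro H hH
      have h1 := (Finset.mem_filter.mp hH).2
      have h2 := g.rk_le_top H
      omega
  obtain ⟨a, ha⟩ : ∃ a, g.rk ⊤ = a + m + 3 := ⟨g.rk ⊤ - (m + 3), by omega⟩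
  have hne : (⊥ : P) ≠ ⊤ := by
    intro h
    rw [← h, g.rk_bot] at ha
    omega
  have h1 := g.vol_mul_le_sq_of_isNef (l := List.replicate a alpha ++ List.replicate m beta)
    (S := {⊥, ⊤}) (by
      intro c hc
      rcases List.mem_append.mp hc with hc | hc
      · rw [List.eq_of_mem_replicate hc]; exact g.isNef_alpha
      · rw [List.eq_of_mem_replicate hc]; exact g.isNef_beta) isFace_pair
    (by rw [Finset.card_pair hne]; simp; omega) g.isNef_beta alpha
  have hmid : ∀ n, List.Perm (beta :: (List.replicate a alpha ++ List.replicate n beta))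
      (List.replicate a (alpha : P → ℝ) ++ List.replicate (n + 1) beta) := fun n =>
    List.perm_middle.symm
  have h2 := g.vol_perm (((hmid m).cons beta).trans (hmid (m + 1))) _ isFace_pair
  have h3 := g.vol_perm ((hmid m).cons alpha) _ isFace_pair
  rw [h2, h3, ← List.cons_append, ← List.cons_append, ← List.cons_append, ← List.replicate_succ,
    ← List.replicate_succ, g.vol_pair_alpha_beta hb₀ hb (by omega),
    g.vol_pair_alpha_beta hb₀ hb (by omega), g.vol_pair_alpha_beta hb₀ hb (by omega)] at h1
  exact h1

theorem sum_rk_eq_add {k : ℕ} (hk : k < g.rk ⊤) :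
    ∑ H with g.rk H = k, b H = ∑ H with g.rk H = k, g.size H / g.size ⊤ * b H +
      ∑ H with g.rk H = k + 1, g.size H / g.size ⊤ * b H := by
  have htop : (⊤ : P) ≠ ⊥ := by
    intro h
    rw [h, g.rk_bot] at hk
    omega
  have hn := (g.size_pos htop).ne'
  have h1 : ∀ H ∈ Finset.univ.filter (fun H => g.rk H = k + 1), g.size H / g.size ⊤ * b H =
      ∑ F with g.rk F = k, if F < H then (g.size H - g.size F) * (b F / g.size ⊤) else 0 := by
    intro H hH
    have hrk := (Finset.mem_filter.mp hH).2
    have hHne : H ≠ ⊥ := by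
      rintro rfl
      rw [g.rk_bot] at hrk
      omega
    have := (g.size_pos hHne).ne'
    rw [hb H hHne, Finset.mul_sum, ← Finset.sum_filter, Finset.filter_filter]
    refine Finset.sum_congr (Finset.filter_congr fun F _ => ?_) fun F _ => ?_
    · rw [hrk, add_left_inj, and_comm]
    · field_simp
  rw [Finset.sum_congr rfl h1, Finset.sum_comm, ← Finset.sum_add_distrib]
  refine Finset.sum_congr rfl fun F hF => ?_
  have hrk := (Finset.mem_filter.mp hF).2
  have hFtop : F < ⊤ := lt_top_iff_ne_top.mpr (by rintro rfl; omega)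
  rw [← Finset.sum_filter, Finset.filter_filter, ← Finset.sum_mul, g.sum_size_cover F ⊤ hFtop]
  · field_simp
    ring
  · intro H
    simp only [Finset.mem_filter, Finset.mem_univ, true_and, le_top, hrk]
    exact and_comm

/-- The Whitney numbers of the first kind of a geometric lattice form a log-concave sequence. -/
theorem whitney_log_concave {k : ℕ} (hk : k + 2 ≤ g.rk ⊤) :
    (∑ H with g.rk H = k, b H) * (∑ H with g.rk H = k + 2, b H) ≤
      (∑ H with g.rk H = k + 1, b H) ^ 2 := by
  set A : ℕ → ℝ := fun k => ∑ H with g.rk H = k, g.size H / g.size ⊤ * b H with hA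
  have hnonneg : ∀ k, 0 ≤ A k := fun k => Finset.sum_nonneg fun H _ => mul_nonneg
    (div_nonneg (g.size_bot ▸ g.size_strictMono.monotone bot_le)
      (g.size_bot ▸ g.size_strictMono.monotone bot_le)) (g.pos_of_recursion hb₀ hb H).le
  have hpos : ∀ k, k + 1 ≤ g.rk ⊤ → 0 < A (k + 1) := by
    intro k hk
    have hne : ∀ H : P, g.rk H = k + 1 → H ≠ ⊥ := by
      rintro H hH rfl
      rw [g.rk_bot] at hH
      omega
    refine Finset.sum_pos (fun H hH => mul_pos (div_pos (g.size_pos ?_) (g.size_pos ?_))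
      (g.pos_of_recursion hb₀ hb H)) ?_
    · exact hne H (Finset.mem_filter.mp hH).2
    · intro h
      rw [h, g.rk_bot] at hk
      omega
    · obtain ⟨H, -, hH⟩ := g.exists_le_rk_eq ⊤ (k + 1) hk
      exact ⟨H, Finset.mem_filter.mpr ⟨Finset.mem_univ _, hH⟩⟩
  have hlast : ∑ H with g.rk H = k + 2, b H = A (k + 2) + A (k + 3) := by
    rcases hk.lt_or_eq with h | h
    · exact g.sum_rk_eq_add hb₀ hb h
    · have h0 : A (k + 3) = 0 := Finset.sum_eq_zero fun H hH => by
        have h1 := (Finset.mem_filter.mp hH).2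
        have h2 := g.rk_le_top H
        omega
      rw [h0, add_zero]
      refine Finset.sum_congr rfl fun H hH => ?_
      have h1 := (Finset.mem_filter.mp hH).2
      have h2 : H = ⊤ := g.eq_of_rk_eq_of_comparable (by omega) (Or.inl le_top)
      rw [h2, div_self (g.size_pos ?_).ne', one_mul]
      intro h3
      rw [h3, g.rk_bot] at h
      omega
  rw [hlast, g.sum_rk_eq_add hb₀ hb (by omega : k < g.rk ⊤),
    g.sum_rk_eq_add hb₀ hb (by omega : k + 1 < g.rk ⊤)]
  change (A k + A (k + 1)) * (A (k + 2) + A (k + 3)) ≤ (A (k + 1) + A (k + 2)) ^ 2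
  have l1 : A k * A (k + 2) ≤ A (k + 1) ^ 2 := g.reduced_log_concave hb₀ hb k
  have l2 : A (k + 1) * A (k + 3) ≤ A (k + 2) ^ 2 := g.reduced_log_concave hb₀ hb (k + 1)
  have p1 : 0 < A (k + 1) := hpos k (by omega)
  have p2 : 0 < A (k + 2) := hpos (k + 1) (by omega)
  have l3 : A k * A (k + 3) ≤ A (k + 1) * A (k + 2) := by
    refine le_of_mul_le_mul_right ?_ (mul_pos p1 p2)
    calc A k * A (k + 3) * (A (k + 1) * A (k + 2))
        = (A k * A (k + 2)) * (A (k + 1) * A (k + 3)) := by ring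
      _ ≤ A (k + 1) ^ 2 * A (k + 2) ^ 2 :=
        mul_le_mul l1 l2 (mul_nonneg p1.le (hnonneg _)) (sq_nonneg _)
      _ = A (k + 1) * A (k + 2) * (A (k + 1) * A (k + 2)) := by ring
  nlinarith

end recursion

end GeometricGrading

namespace Matroid

open scoped Classical

variable {α : Type*} {M : Matroid α}

theorem coe_matroidRank [M.RankFinite] (X : Set α) : (matroidRank M X : ℕ∞) = M.eRk X := by
  obtain ⟨I, hI⟩ := M.exists_isBasis' X
  rw [hI.eRk_eq_encard, ← hI.indep.finite.cast_ncard_eq, Nat.cast_inj]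
  refine IsGreatest.csSup_eq ⟨⟨I, hI.subset, hI.indep, rfl⟩, ?_⟩
  rintro n ⟨J, hJX, hJ, rfl⟩
  have := hJ.encard_le_eRk_of_subset hJX
  rwa [hI.eRk_eq_encard, ← hI.indep.finite.cast_ncard_eq, ← hJ.finite.cast_ncard_eq,
    Nat.cast_le] at this

theorem matroidRank_closure [M.RankFinite] (X : Set α) :
    matroidRank M (M.closure X) = matroidRank M X := by
  rw [← Nat.cast_inj (R := ℕ∞), coe_matroidRank, coe_matroidRank, eRk_closure_eq]

theorem matroidRank_insert [M.RankFinite] {X : Set α} {e : α} (he : e ∈ M.E \ M.closure X) :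
    matroidRank M (insert e X) = matroidRank M X + 1 := by
  rw [← Nat.cast_inj (R := ℕ∞), Nat.cast_add, coe_matroidRank, coe_matroidRank, Nat.cast_one,
    eRk_insert_eq_add_one he]

theorem matroidRank_mono [M.RankFinite] {X Y : Set α} (h : X ⊆ Y) :
    matroidRank M X ≤ matroidRank M Y := by
  rw [← Nat.cast_le (α := ℕ∞), coe_matroidRank, coe_matroidRank]
  exact M.eRk_mono h

theorem matroidRank_empty [M.RankFinite] : matroidRank M ∅ = 0 := by
  rw [← Nat.cast_inj (R := ℕ∞), coe_matroidRank, eRk_empty, Nat.cast_zero]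

theorem matroidRank_inter_add_union_le [M.RankFinite] (X Y : Set α) :
    matroidRank M (X ∩ Y) + matroidRank M (X ∪ Y) ≤ matroidRank M X + matroidRank M Y := by
  rw [← Nat.cast_le (α := ℕ∞), Nat.cast_add, Nat.cast_add]
  simp only [coe_matroidRank]
  exact M.eRk_inter_add_eRk_union_le X Y

theorem IsFlat.eq_of_matroidRank_le [M.RankFinite] {F G : Set α} (hF : M.IsFlat F)
    (hG : M.IsFlat G) (h : F ⊆ G) (hrk : matroidRank M G ≤ matroidRank M F) : F = G := by
  rw [← hF.closure, ← hG.closure]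
  refine (M.isRkFinite_set F).closure_eq_closure_of_subset_of_eRk_ge_eRk h ?_
  rwa [← coe_matroidRank, ← coe_matroidRank, Nat.cast_le]

/-- A flat covering `A` is spanned by `A` and any of its elements outside `A`. -/
theorem IsFlat.closure_insert_eq [M.RankFinite] {A F : Set α} (hA : M.IsFlat A) (hF : M.IsFlat F)
    (hAF : A ⊆ F) (hrk : matroidRank M F = matroidRank M A + 1) {e : α} (he : e ∈ F \ A) :
    M.closure (insert e A) = F := by
  refine (M.isFlat_closure _).eq_of_matroidRank_le hF ?_ ?_
  · rw [← hF.closure]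
    exact M.closure_subset_closure (Set.insert_subset he.1 hAF)
  · rw [matroidRank_closure, matroidRank_insert, hrk]
    rw [hA.closure]
    exact ⟨hF.subset_ground he.1, he.2⟩

/-- The type of flats of a matroid. -/
abbrev Flat (M : Matroid α) : Type _ := {F : Set α // M.IsFlat F}

noncomputable instance [M.Finite] : Fintype M.Flat :=
  Set.Finite.fintype (s := {F | M.IsFlat F})
    (M.ground_finite.finite_subsets.subset fun _ hF => hF.subset_ground)

instance : BoundedOrder M.Flat where
  top := ⟨M.E, M.ground_isFlat⟩
  le_top F := F.2.subset_ground
  bot := ⟨M.closure ∅, M.isFlat_closure _⟩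
  bot_le F := by
    rw [← Subtype.coe_le_coe, ← F.2.closure]
    exact M.closure_subset_closure (Set.empty_subset _)

theorem Flat.coe_bot [M.Loopless] : ((⊥ : M.Flat) : Set α) = ∅ :=
  M.loops_eq_empty

/-- The grading of the lattice of flats of a finite loopless matroid by rank and cardinality. -/
noncomputable def flatGrading (M : Matroid α) [M.Finite] [M.Loopless] :
    GeometricGrading M.Flat where
  rk F := matroidRank M (F : Set α)
  size F := ∑ e ∈ M.ground_finite.toFinset, if e ∈ (F : Set α) then 1 else 0
  rk_bot := by rw [Flat.coe_bot, matroidRank_empty]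
  size_bot := by simp [Flat.coe_bot]
  rk_strictMono F G hFG := by
    by_contra! h
    exact hFG.ne (Subtype.ext (F.2.eq_of_matroidRank_le G.2 hFG.le h))
  size_strictMono F G hFG := by
    obtain ⟨hle, e, heG, heF⟩ := Set.ssubset_iff_exists.mp (Subtype.coe_lt_coe.mpr hFG)
    refine Finset.sum_lt_sum (fun i _ => ?_) ⟨e, ?_, by simp [heG, heF]⟩
    · by_cases hi : i ∈ (F : Set α)
      · simp [hi, hle hi]
      · rw [if_neg hi]
        split_ifs <;> norm_num
    · simpa using G.2.subset_ground heG
  sum_size_cover A B hAB s hs := by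
    simp only [← Finset.sum_sub_distrib]
    rw [Finset.sum_comm]
    refine Finset.sum_congr rfl fun e he => ?_
    have heE : e ∈ M.E := by simpa using he
    by_cases heA : e ∈ (A : Set α)
    · rw [if_pos heA, if_pos (hAB.le heA), sub_self]
      exact Finset.sum_eq_zero fun F hF => by
        rw [if_pos (((hs F).mp hF).1.le heA), sub_self]
    · simp only [if_neg heA, sub_zero]
      by_cases heB : e ∈ (B : Set α)
      · have hL : M.closure (insert e (A : Set α)) ⊆ B := by
          rw [← B.2.closure]
          exact M.closure_subset_closure (Set.insert_subset heB hAB.le)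
        have heL : e ∈ M.closure (insert e (A : Set α)) :=
          M.mem_closure_of_mem' (Set.mem_insert _ _) heE
        have hAL : (A : Set α) ⊆ M.closure (insert e (A : Set α)) :=
          (Set.subset_insert _ _).trans
            (M.subset_closure _ (Set.insert_subset heE A.2.subset_ground))
        rw [if_pos heB, Finset.sum_eq_single_of_mem ⟨_, M.isFlat_closure (insert e (A : Set α))⟩]
        · rw [if_pos heL]
        · refine (hs _).mpr ⟨lt_of_le_of_ne hAL fun h => ?_, hL, ?_⟩
          · rw [h] at heA
            exact heA heL
          · rw [matroidRank_closure, matroidRank_insert]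
            rw [A.2.closure]
            exact ⟨heE, heA⟩
        · intro F hF hne
          rw [if_neg]
          intro heF
          obtain ⟨h1, -, h3⟩ := (hs F).mp hF
          exact hne (Subtype.ext (A.2.closure_insert_eq F.2 h1.le h3 ⟨heF, heA⟩).symm)
      · rw [if_neg heB]
        exact Finset.sum_eq_zero fun F hF => if_neg fun h => heB (((hs F).mp hF).2.1 h)
  exists_join A F G hAF hAG hF hG hne := by
    have hE : (F : Set α) ∪ G ⊆ M.E := Set.union_subset F.2.subset_ground G.2.subset_ground
    have hFL : (F : Set α) ⊆ M.closure (F ∪ G) := Set.subset_union_left.trans (M.subset_closure _ hE)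
    have hGL : (G : Set α) ⊆ M.closure (F ∪ G) :=
      Set.subset_union_right.trans (M.subset_closure _ hE)
    refine ⟨⟨M.closure (F ∪ G), M.isFlat_closure _⟩, ?_, hFL, hGL, fun B hFB hGB => ?_⟩
    · have h1 := M.matroidRank_inter_add_union_le (F : Set α) G
      have h2 : matroidRank M (A : Set α) ≤ matroidRank M ((F : Set α) ∩ G) :=
        matroidRank_mono (Set.subset_inter hAF.le hAG.le)
      have h3 : matroidRank M (F : Set α) < matroidRank M (M.closure ((F : Set α) ∪ G)) := by
        by_contra! h
        have h4 := F.2.eq_of_matroidRank_le (M.isFlat_closure _) hFL h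
        refine hne (Subtype.ext (G.2.eq_of_matroidRank_le F.2 ?_ (by omega)).symm)
        rw [h4]
        exact hGL
      rw [matroidRank_closure] at h3 ⊢
      omega
    · rw [← Subtype.coe_le_coe, ← B.2.closure]
      exact M.closure_subset_closure (Set.union_subset hFB hGB)

/-- The signed number of spanning subsets of a flat `F`, which equals the Möbius function
`μ(∅, F)` of the lattice of flats. -/
noncomputable def Flat.moebius [M.Finite] (F : M.Flat) : ℤ :=
  ∑ S ∈ M.ground_finite.toFinset.powerset,
    if M.closure (S : Set α) = F then (-1) ^ S.card else 0

theorem Flat.moebius_bot [M.Finite] [M.Loopless] : (⊥ : M.Flat).moebius = 1 := by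
  rw [Flat.moebius, Finset.sum_eq_single_of_mem ∅ (Finset.empty_mem_powerset _)]
  · rw [Finset.coe_empty, if_pos (show M.closure ∅ = ((⊥ : M.Flat) : Set α) from rfl),
      Finset.card_empty, pow_zero]
  · intro S hS hne
    rw [if_neg]
    intro h
    have hSE : (S : Set α) ⊆ M.E := by simpa using hS
    rw [Flat.coe_bot] at h
    have := M.subset_closure (S : Set α) hSE
    rw [h, Set.subset_empty_iff, Finset.coe_eq_empty] at this
    exact hne this

theorem Flat.indicator_sub_indicator_insert [M.Finite] {F : M.Flat} {e : α}
    (he : e ∈ (F : Set α)) (X : Set α) :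
    (if M.closure X = F then 1 else 0) - (if M.closure (insert e X) = F then 1 else 0) =
      -∑ H : M.Flat with (H < F ∧ matroidRank M (H : Set α) + 1 = matroidRank M (F : Set α)) ∧
        e ∉ (H : Set α), if M.closure X = H then (1 : ℤ) else 0 := by
  have heE : e ∈ M.E := F.2.subset_ground he
  by_cases heX : e ∈ M.closure X
  · rw [closure_insert_eq_of_mem_closure heX, sub_self, Finset.sum_eq_zero, neg_zero]
    intro H hH
    rw [if_neg]
    intro h
    rw [h] at heX
    exact (Finset.mem_filter.mp hH).2.2 heX
  · have h1 : M.closure X ≠ F := by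
      intro h
      rw [h] at heX
      exact heX he
    rw [if_neg h1, zero_sub, neg_inj]
    split_ifs with h2
    · symm
      rw [Finset.sum_eq_single_of_mem ⟨M.closure X, M.isFlat_closure X⟩]
      · rw [if_pos rfl]
      · refine Finset.mem_filter.mpr ⟨Finset.mem_univ _, ⟨lt_of_le_of_ne ?_ ?_, ?_⟩, heX⟩
        · rw [← Subtype.coe_le_coe, ← h2]
          exact M.closure_subset_closure (Set.subset_insert e X)
        · exact fun h => h1 (congrArg Subtype.val h)
        · rw [← h2, matroidRank_closure, matroidRank_closure, matroidRank_insert ⟨heE, heX⟩]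
      · intro H _ hne
        rw [if_neg]
        exact fun h => hne (Subtype.ext h.symm)
    · symm
      refine Finset.sum_eq_zero fun H hH => ?_
      obtain ⟨-, ⟨hlt, hrk⟩, heH⟩ := Finset.mem_filter.mp hH
      rw [if_neg]
      intro h
      apply h2
      rw [← closure_insert_closure_eq_closure_insert, h]
      exact H.2.closure_insert_eq F.2 hlt.le hrk.symm ⟨he, heH⟩

theorem Flat.moebius_eq_sum_sub [M.Finite] (F : M.Flat) {e : α} (he : e ∈ M.E) :
    F.moebius = ∑ S ∈ (M.ground_finite.toFinset.erase e).powerset, (-1) ^ S.card *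
      ((if M.closure (S : Set α) = F then 1 else 0) -
        (if M.closure (insert e (S : Set α)) = F then 1 else 0)) := by
  have h : M.ground_finite.toFinset = insert e (M.ground_finite.toFinset.erase e) := by
    rw [Finset.insert_erase (by simpa using he)]
  rw [Flat.moebius]
  conv_lhs => rw [h]
  rw [Finset.sum_powerset_insert (Finset.notMem_erase _ _), ← Finset.sum_add_distrib]
  refine Finset.sum_congr rfl fun S hS => ?_
  have heS : e ∉ S := fun h => Finset.notMem_erase _ _ (Finset.mem_powerset.mp hS h)
  rw [Finset.card_insert_of_notMem heS, Finset.coe_insert]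
  split_ifs <;> ring

/-- Weisner's theorem for the lattice of flats. -/
theorem Flat.moebius_eq_neg_sum [M.Finite] (F : M.Flat) {e : α} (he : e ∈ (F : Set α)) :
    F.moebius = -∑ H : M.Flat with
      (H < F ∧ matroidRank M (H : Set α) + 1 = matroidRank M (F : Set α)) ∧ e ∉ (H : Set α),
        H.moebius := by
  have heE : e ∈ M.E := F.2.subset_ground he
  have hH : ∀ H ∈ Finset.univ.filter fun H : M.Flat =>
      (H < F ∧ matroidRank M (H : Set α) + 1 = matroidRank M (F : Set α)) ∧ e ∉ (H : Set α),
      H.moebius = ∑ S ∈ (M.ground_finite.toFinset.erase e).powerset,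
        (-1) ^ S.card * (if M.closure (S : Set α) = H then 1 else 0) := by
    intro H hH
    rw [H.moebius_eq_sum_sub heE]
    refine Finset.sum_congr rfl fun S _ => ?_
    rw [if_neg (c := M.closure (insert e (S : Set α)) = H), sub_zero]
    intro h
    apply (Finset.mem_filter.mp hH).2.2
    rw [← h]
    exact M.mem_closure_of_mem' (Set.mem_insert _ _) heE
  rw [Finset.sum_congr rfl hH, Finset.sum_comm, F.moebius_eq_sum_sub heE, ← Finset.sum_neg_distrib]
  refine Finset.sum_congr rfl fun S _ => ?_
  rw [Flat.indicator_sub_indicator_insert he, mul_neg, Finset.mul_sum]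

/-- The absolute value of the Möbius function. -/
noncomputable def Flat.absMoebius [M.Finite] (F : M.Flat) : ℝ :=
  (-1) ^ matroidRank M (F : Set α) * (F.moebius : ℝ)

theorem Flat.absMoebius_eq_sum [M.Finite] (F : M.Flat) {e : α} (he : e ∈ (F : Set α)) :
    F.absMoebius = ∑ H : M.Flat with
      H < F ∧ matroidRank M (H : Set α) + 1 = matroidRank M (F : Set α),
        if e ∈ (H : Set α) then 0 else H.absMoebius := by
  rw [Flat.absMoebius, F.moebius_eq_neg_sum he, ← Finset.filter_filter, Finset.sum_filter]
  push_cast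
  rw [← Finset.sum_neg_distrib, Finset.mul_sum]
  refine Finset.sum_congr rfl fun H hH => ?_
  rw [Flat.absMoebius, ← (Finset.mem_filter.mp hH).2.2, ite_not]
  split_ifs
  · rw [neg_zero, mul_zero]
  · ring

theorem Flat.absMoebius_recursion [M.Finite] [M.Loopless] (F : M.Flat) (hF : F ≠ ⊥) :
    F.absMoebius = ∑ H with H < F ∧ M.flatGrading.rk H + 1 = M.flatGrading.rk F,
      (1 - M.flatGrading.size H / M.flatGrading.size F) * H.absMoebius := by
  have hpos := M.flatGrading.size_pos hF
  have key : M.flatGrading.size F * F.absMoebius =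
      ∑ H with H < F ∧ M.flatGrading.rk H + 1 = M.flatGrading.rk F,
        (M.flatGrading.size F - M.flatGrading.size H) * H.absMoebius := by
    have hsize (G : M.Flat) : M.flatGrading.size G =
      ∑ e ∈ M.ground_finite.toFinset, if e ∈ (G : Set α) then 1 else 0 := rfl
    simp only [hsize, ← Finset.sum_sub_distrib, Finset.sum_mul]
    rw [Finset.sum_comm]
    refine Finset.sum_congr rfl fun e _ => ?_
    by_cases he : e ∈ (F : Set α)
    · rw [if_pos he, one_mul, F.absMoebius_eq_sum he]
      refine Finset.sum_congr rfl fun H _ => ?_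
      split_ifs <;> simp
    · rw [if_neg he, zero_mul, Finset.sum_eq_zero]
      intro H hH
      rw [if_neg fun h => he ((Finset.mem_filter.mp hH).2.1.le h)]
      simp
  rw [← mul_right_inj' hpos.ne', key, Finset.mul_sum]
  refine Finset.sum_congr rfl fun H _ => ?_
  field_simp

/-- The characteristic polynomial as a sum over flats, grouped by rank. -/
theorem sum_powerset_eq_sum_moebius [M.Finite] (q : ℤ) :
    ∑ S ∈ M.ground_finite.toFinset.powerset,
        (-1 : ℤ) ^ S.card * q ^ (matroidRank M M.E - matroidRank M (S : Set α)) =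
      ∑ k ∈ Finset.range (matroidRank M M.E + 1),
        (∑ F ∈ Finset.univ.filter fun F : M.Flat => matroidRank M (F : Set α) = k, F.moebius) *
          q ^ (matroidRank M M.E - k) := by
  have h1 : ∑ k ∈ Finset.range (matroidRank M M.E + 1),
        (∑ F ∈ Finset.univ.filter fun F : M.Flat => matroidRank M (F : Set α) = k, F.moebius) *
          q ^ (matroidRank M M.E - k) =
      ∑ F : M.Flat, F.moebius * q ^ (matroidRank M M.E - matroidRank M (F : Set α)) := by
    rw [← Finset.sum_fiberwise_of_maps_to (s := Finset.univ)
      (t := Finset.range (matroidRank M M.E + 1)) (g := fun F : M.Flat => matroidRank M (F : Set α))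
      fun F _ => Finset.mem_range.mpr (Nat.lt_succ_of_le (matroidRank_mono F.2.subset_ground))]
    refine Finset.sum_congr rfl fun k _ => ?_
    rw [Finset.sum_mul]
    refine Finset.sum_congr rfl fun F hF => ?_
    rw [(Finset.mem_filter.mp hF).2]
  rw [h1]
  simp only [Flat.moebius, Finset.sum_mul]
  rw [Finset.sum_comm]
  refine Finset.sum_congr rfl fun S _ => ?_
  rw [Finset.sum_eq_single_of_mem ⟨M.closure (S : Set α), M.isFlat_closure _⟩ (Finset.mem_univ _)]
  · rw [if_pos rfl, matroidRank_closure]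
  · intro F _ hne
    rw [if_neg fun h => hne (Subtype.ext h.symm), zero_mul]

/-- The `k`-th Whitney number of the first kind, up to sign. -/
noncomputable def whitney (M : Matroid α) [M.Finite] (k : ℕ) : ℤ :=
  (-1) ^ k * ∑ F ∈ Finset.univ.filter fun F : M.Flat => matroidRank M (F : Set α) = k, F.moebius

theorem cast_whitney [M.Finite] (k : ℕ) :
    (M.whitney k : ℝ) = ∑ F ∈ Finset.univ.filter fun F : M.Flat =>
      matroidRank M (F : Set α) = k, F.absMoebius := by
  rw [whitney]
  push_cast
  rw [Finset.mul_sum]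
  refine Finset.sum_congr rfl fun F hF => ?_
  rw [Flat.absMoebius, (Finset.mem_filter.mp hF).2]

theorem absMoebius_bot [M.Finite] [M.Loopless] : (⊥ : M.Flat).absMoebius = 1 := by
  rw [Flat.absMoebius, Flat.moebius_bot, Flat.coe_bot, matroidRank_empty]
  simp

theorem whitney_nonneg [M.Finite] [M.Loopless] (k : ℕ) : 0 ≤ M.whitney k := by
  rw [← Int.cast_nonneg_iff (R := ℝ), cast_whitney]
  exact Finset.sum_nonneg fun F _ =>
    (M.flatGrading.pos_of_recursion absMoebius_bot Flat.absMoebius_recursion F).le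

theorem whitney_mul_whitney_le [M.Finite] [M.Loopless] {k : ℕ} (hk : k + 2 ≤ matroidRank M M.E) :
    M.whitney k * M.whitney (k + 2) ≤ M.whitney (k + 1) ^ 2 := by
  rw [← Int.cast_le (R := ℝ)]
  push_cast
  simp only [cast_whitney]
  exact M.flatGrading.whitney_log_concave absMoebius_bot Flat.absMoebius_recursion hk

end Matroid

/-- Rota–Heron–Welsh conjecture, proved by Adiprasito–Huh–Katz: let `M` be a
loopless matroid of rank `r` on a finite ground set `E`. Then there are nonnegative integers
`w_0, …, w_r` with `χ_M(q) = ∑_{S ⊆ E} (−1)^{|S|} q^{r − rk(S)} = ∑_{k=0}^r (−1)^k w_k q^{r−k}`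
(as polynomials in `q`, i.e. for all natural numbers `q`), and these satisfy
`w_k^2 ≥ w_{k−1} ⬝ w_{k+1}` for `1 ≤ k ≤ r − 1`. -/
theorem characteristic_polynomial_log_concave {α : Type*} (M : Matroid α)
    (hfin : M.E.Finite) (hloopless : ∀ e ∈ M.E, M.Indep {e})
    (r : ℕ) (hr : matroidRank M M.E = r) :
    ∃ w : ℕ → ℕ,
      (∀ q : ℕ, ∑ S ∈ hfin.toFinset.powerset,
          (-1 : ℤ) ^ S.card * (q : ℤ) ^ (r - matroidRank M (S : Set α)) =
        ∑ k ∈ Finset.range (r + 1), (-1 : ℤ) ^ k * (w k : ℤ) * (q : ℤ) ^ (r - k)) ∧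
      ∀ k, 1 ≤ k → k + 1 ≤ r → w (k - 1) * w (k + 1) ≤ w k * w k := by
  have : M.Finite := ⟨hfin⟩
  have : M.Loopless := Matroid.loopless_iff_forall_isNonloop.mpr fun e he =>
    Matroid.indep_singleton.mp (hloopless e he)
  have hw (k : ℕ) : ((M.whitney k).toNat : ℤ) = M.whitney k :=
    Int.toNat_of_nonneg (Matroid.whitney_nonneg k)
  subst hr
  refine ⟨fun k => (M.whitney k).toNat, fun q => ?_, fun k h1 h2 => ?_⟩
  · rw [Matroid.sum_powerset_eq_sum_moebius]
    refine Finset.sum_congr rfl fun k _ => ?_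
    rw [hw, Matroid.whitney, ← mul_assoc, ← mul_pow, neg_one_mul, neg_neg, one_pow, one_mul]
  · obtain ⟨k, rfl⟩ := Nat.exists_eq_add_of_le' h1
    have := Matroid.whitney_mul_whitney_le (M := M) h2
    zify
    rw [hw, hw, hw, ← sq]
    exact this
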